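/- (Proposition 3, direct part) For any unitary operators V, W : 𝕳₋ → 𝕳₊, the operator X_{V,W} is a self-adjoint operator on H extending X; moreover U maps D(X_{V,W}) onto D(X_{V,W}) and U* X_{V,W} U = q X_{V,W}. -/

import Mathlib

open MeasureTheory

noncomputable section

/-- The Hilbert sum `⊕_j L²(ν j)` of `L²`-spaces, as an `l²`-direct sum. -/
abbrev HS {I : Type*} (ν : I → Measure ℝ) : Type _ := lp (fun j => Lp ℂ 2 (ν j)) 2

/-- The measure `t⁻¹ dμ₁` on `[q,1)`. -/
def wd (μ1 : Measure ℝ) : Measure ℝ := μ1.withDensity fun t => ENNReal.ofReal t⁻¹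

/-- `μ` is the measure on `ℝ₊ = (0,∞)` induced by `μ₁` via `μ(qⁿM) = qⁿμ₁(M)`. -/
def IsInducedPlus (q : ℝ) (μ1 μ : Measure ℝ) : Prop :=
  μ (Set.Ioi (0 : ℝ))ᶜ = 0 ∧
  ∀ M : Set ℝ, MeasurableSet M → M ⊆ Set.Ico q 1 → ∀ n : ℤ,
    μ ((fun t => q ^ n * t) '' M) = ENNReal.ofReal (q ^ n) * μ1 M

/-- `μ` is the measure on `ℝ₋ = (−∞,0)` induced by `μ₁` via `μ(−qⁿM) = qⁿμ₁(M)`. -/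
def IsInducedMinus (q : ℝ) (μ1 μ : Measure ℝ) : Prop :=
  μ (Set.Iio (0 : ℝ))ᶜ = 0 ∧
  ∀ M : Set ℝ, MeasurableSet M → M ⊆ Set.Ico q 1 → ∀ n : ℤ,
    μ ((fun t => -(q ^ n * t)) '' M) = ENNReal.ofReal (q ^ n) * μ1 M

/-- `U` acts componentwise by `(Uf)(t) = q^{1/2} f(qt)`. -/
def IsUop (q : ℝ) {I : Type*} (ν : I → Measure ℝ) (U : HS ν ≃ₗᵢ[ℂ] HS ν) : Prop :=
  ∀ f : HS ν, ∀ j : I, ∀ᵐ t ∂(ν j),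
    ((U f : HS ν) j) t = ((q ^ ((1 : ℝ)/2) : ℝ) : ℂ) * ((f : HS ν) j) (q * t)

/-- `P` is the (maximal) multiplication operator `(Pf)(t) = t f(t)`, componentwise. -/
def IsPop {I : Type*} (ν : I → Measure ℝ) (P : HS ν →ₗ.[ℂ] HS ν) : Prop :=
  (∀ f : HS ν, f ∈ P.domain ↔
    ∃ g : HS ν, ∀ j : I, ∀ᵐ t ∂(ν j), (g j) t = (t : ℂ) * (f j) t) ∧
  (∀ f : P.domain, ∀ j : I, ∀ᵐ t ∂(ν j),
    ((P f) j) t = (t : ℂ) * ((f : HS ν) j) t)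

/-- `X` is the symmetric operator `(Xf)(t) = i t⁻¹(f(q⁻¹t) − f(qt))` on
`D(X) = {f : t⁻¹f ∈ H}`, componentwise. -/
def IsXop (q : ℝ) {I : Type*} (ν : I → Measure ℝ) (X : HS ν →ₗ.[ℂ] HS ν) : Prop :=
  (∀ f : HS ν, f ∈ X.domain ↔
    ∃ g : HS ν, ∀ j : I, ∀ᵐ t ∂(ν j), (g j) t = (t : ℂ)⁻¹ * (f j) t) ∧
  (∀ f : X.domain, ∀ j : I, ∀ᵐ t ∂(ν j),
    ((X f) j) t = Complex.I * (t : ℂ)⁻¹ *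
      (((f : HS ν) j) (q⁻¹ * t) - ((f : HS ν) j) (q * t)))

/-- `he` is the "even extension" `h^e` of `h : [q,1) → ℂ` to `ℝ₊`. -/
def IsEvenExt (q : ℝ) (h he : ℝ → ℂ) : Prop :=
  (∀ n : ℕ, ∀ t ∈ Set.Ico q 1, he (q ^ (2 * n) * t) = h t) ∧
  (∀ t : ℝ, (¬ ∃ n : ℕ, ∃ s ∈ Set.Ico q 1, t = q ^ (2 * n) * s) → he t = 0)

/-- `ho` is the "odd extension" `h^o` of `h : [q,1) → ℂ` to `ℝ₊`. -/
def IsOddExt (q : ℝ) (h ho : ℝ → ℂ) : Prop :=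
  (∀ n : ℕ, ∀ t ∈ Set.Ico q 1, ho (q ^ (2 * n + 1) * t) = h t) ∧
  (∀ t : ℝ, (¬ ∃ n : ℕ, ∃ s ∈ Set.Ico q 1, t = q ^ (2 * n + 1) * s) → ho t = 0)

/-- Even extension to the negative half-axis. -/
def IsEvenExtNeg (q : ℝ) (h he : ℝ → ℂ) : Prop :=
  (∀ n : ℕ, ∀ t ∈ Set.Ico q 1, he (-(q ^ (2 * n) * t)) = h t) ∧
  (∀ t : ℝ, (¬ ∃ n : ℕ, ∃ s ∈ Set.Ico q 1, t = -(q ^ (2 * n) * s)) → he t = 0)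

/-- Odd extension to the negative half-axis. -/
def IsOddExtNeg (q : ℝ) (h ho : ℝ → ℂ) : Prop :=
  (∀ n : ℕ, ∀ t ∈ Set.Ico q 1, ho (-(q ^ (2 * n + 1) * t)) = h t) ∧
  (∀ t : ℝ, (¬ ∃ n : ℕ, ∃ s ∈ Set.Ico q 1, t = -(q ^ (2 * n + 1) * s)) → ho t = 0)

/-- `(be, bo, ce, co) ∈ 𝕳₊ ⊕ 𝕳₊ ⊕ 𝕳₋ ⊕ 𝕳₋` are the boundary vectors
`(𝔣_e^+, 𝔣_o^+, 𝔣_e^−, 𝔣_o^−)` of `𝔣 ∈ D(X*)` coming from the componentwise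
decomposition `𝔣 = 𝔣_X + 𝔣^e + 𝔣^o` of Lemma 1. -/
def IsBdry (q : ℝ) {Ip Im : Type*} (μp : Ip → Measure ℝ) (μm : Im → Measure ℝ)
    (μ1p : Ip → Measure ℝ) (μ1m : Im → Measure ℝ)
    (X : HS (Sum.elim μp μm) →ₗ.[ℂ] HS (Sum.elim μp μm))
    (f : HS (Sum.elim μp μm))
    (be bo : HS (fun j => wd (μ1p j))) (ce co : HS (fun j => wd (μ1m j))) : Prop :=
  f ∈ X.adjoint.domain ∧
  ∃ fX : HS (Sum.elim μp μm), fX ∈ X.domain ∧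
    (∀ j : Ip, ∃ he ho : ℝ → ℂ,
      IsEvenExt q (⇑(be j)) he ∧ IsOddExt q (⇑(bo j)) ho ∧
      ∀ᵐ t ∂(μp j), (f (Sum.inl j)) t = (fX (Sum.inl j)) t + he t + ho t) ∧
    (∀ j : Im, ∃ he ho : ℝ → ℂ,
      IsEvenExtNeg q (⇑(ce j)) he ∧ IsOddExtNeg q (⇑(co j)) ho ∧
      ∀ᵐ t ∂(μm j), (f (Sum.inr j)) t = (fX (Sum.inr j)) t + he t + ho t)

/-- Membership in the domain of `X_{V,W}`: `𝔣 ∈ D(X*)` whose boundary vectors satisfy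
`𝔣_e^+ + 𝔣_o^+ = V(𝔣_e^− + 𝔣_o^−)` and `𝔣_e^+ − 𝔣_o^+ = W(𝔣_e^− − 𝔣_o^−)`. -/
def MemXVW (q : ℝ) {Ip Im : Type*} (μp : Ip → Measure ℝ) (μm : Im → Measure ℝ)
    (μ1p : Ip → Measure ℝ) (μ1m : Im → Measure ℝ)
    (X : HS (Sum.elim μp μm) →ₗ.[ℂ] HS (Sum.elim μp μm))
    (V W : HS (fun j => wd (μ1m j)) ≃ₗᵢ[ℂ] HS (fun j => wd (μ1p j)))
    (f : HS (Sum.elim μp μm)) : Prop :=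
  ∃ (be bo : HS (fun j => wd (μ1p j))) (ce co : HS (fun j => wd (μ1m j))),
    IsBdry q μp μm μ1p μ1m X f be bo ce co ∧
    be + bo = V (ce + co) ∧ be - bo = W (ce - co)

/-- The bounded operator `A` commutes with the (possibly unbounded) operator `T`,
i.e. `T A ⊆ A T`. -/
def CommutesPMap {H : Type*} [NormedAddCommGroup H] [InnerProductSpace ℂ H]
    (A : H →L[ℂ] H) (T : H →ₗ.[ℂ] H) : Prop :=
  ∀ f : T.domain, ∃ h : A f ∈ T.domain, T ⟨A f, h⟩ = A (T f)

/-- `Θ T Θ* = T'` for a unitary `Θ` and (possibly unbounded) operators `T`, `T'`. -/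
def TransportsPMap {H H' : Type*} [NormedAddCommGroup H] [InnerProductSpace ℂ H]
    [NormedAddCommGroup H'] [InnerProductSpace ℂ H']
    (Θ : H ≃ₗᵢ[ℂ] H') (T : H →ₗ.[ℂ] H) (T' : H' →ₗ.[ℂ] H') : Prop :=
  (∀ f : T.domain, ∃ h : Θ f ∈ T'.domain, T' ⟨Θ f, h⟩ = Θ (T f)) ∧
  (∀ g : T'.domain, Θ.symm g ∈ T.domain)


section DirectSum

variable {I : Type*} {ν : I → Measure ℝ}

theorem HS.ext_ae {f g : HS ν} (h : ∀ i, ∀ᵐ t ∂(ν i), f i t = g i t) : f = g := by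
  ext1
  funext i
  exact Lp.ext (h i)

theorem HS.add_ae (f g : HS ν) (i : I) : ∀ᵐ t ∂(ν i), (f + g) i t = f i t + g i t :=
  Lp.coeFn_add (f i) (g i)

theorem HS.sub_ae (f g : HS ν) (i : I) : ∀ᵐ t ∂(ν i), (f - g) i t = f i t - g i t :=
  Lp.coeFn_sub (f i) (g i)

theorem HS.smul_ae (c : ℂ) (f : HS ν) (i : I) : ∀ᵐ t ∂(ν i), (c • f) i t = c * f i t :=
  Lp.coeFn_smul c (f i)

theorem HS.zero_ae (i : I) : ∀ᵐ t ∂(ν i), (0 : HS ν) i t = 0 :=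
  Lp.coeFn_zero ℂ 2 (ν i)

theorem HS.inner_eq_tsum (f g : HS ν) : inner ℂ f g = ∑' i, inner ℂ (f i) (g i) :=
  lp.inner_eq_tsum f g

theorem HS.inner_congr_ae {f g f' g' : HS ν}
    (h : ∀ i, ∀ᵐ t ∂(ν i), inner ℂ (f i t) (g i t) = inner ℂ (f' i t) (g' i t)) :
    inner ℂ f g = inner ℂ f' g' := by
  rw [HS.inner_eq_tsum, HS.inner_eq_tsum]
  refine tsum_congr fun i => ?_
  rw [L2.inner_def, L2.inner_def]
  exact integral_congr_ae (h i)

theorem HS.inner_eq_zero_of_ae {f g : HS ν} (h : ∀ i, ∀ᵐ t ∂(ν i), f i t = 0 ∨ g i t = 0) :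
    inner ℂ f g = 0 := by
  rw [← inner_zero_left (𝕜 := ℂ) g]
  refine HS.inner_congr_ae fun i => ?_
  filter_upwards [h i, HS.zero_ae i] with t ht h0
  rw [h0]
  rcases ht with ht | ht <;> simp [ht]

/-- Assembling an element of a direct sum from square-integrable components. -/
theorem HS.exists_of_memLp {J : Type*} {E : J → Type*} [∀ j, NormedAddCommGroup (E j)]
    (b : lp E 2) (e : I → Option J) (he : ∀ i i' j, e i = some j → e i' = some j → i = i')
    (C : ℝ) (F : I → ℝ → ℂ) (hF : ∀ i, MemLp (F i) 2 (ν i))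
    (h0 : ∀ i, e i = none → eLpNorm (F i) 2 (ν i) = 0)
    (hC : ∀ i j, e i = some j → eLpNorm (F i) 2 (ν i) ≤ ENNReal.ofReal (C * ‖b j‖)) :
    ∃ g : HS ν, ∀ i, ∀ᵐ t ∂(ν i), g i t = F i t := by
  have hsum : Summable fun j => (|C| * ‖b j‖) ^ (2 : ENNReal).toReal := by
    have := ((lp.memℓp b).summable (by norm_num : 0 < (2 : ENNReal).toReal)).mul_left
      (|C| ^ (2 : ENNReal).toReal)
    refine this.congr fun j => ?_
    rw [Real.mul_rpow (abs_nonneg _) (norm_nonneg _)]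
  have hb : ∀ i j, e i = some j → ‖(hF i).toLp (F i)‖ ≤ |C| * ‖b j‖ := by
    intro i j hij
    rw [Lp.norm_toLp]
    refine ENNReal.toReal_le_of_le_ofReal (by positivity) ((hC i j hij).trans ?_)
    exact ENNReal.ofReal_le_ofReal (by gcongr; exact le_abs_self C)
  have hz : ∀ i, e i = none → ‖(hF i).toLp (F i)‖ = 0 := by
    intro i hi
    rw [Lp.norm_toLp, h0 i hi]; simp
  have hmem : Memℓp (fun i => (hF i).toLp (F i)) 2 := by
    refine memℓp_gen ?_
    have hinj : Function.Injective
        (fun i : {i // (e i).isSome} => (e i.1).get i.2) := by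
      rintro ⟨i, hi⟩ ⟨i', hi'⟩ h
      refine Subtype.ext (he i i' _ (Option.some_get hi).symm ?_)
      exact (Option.some_get hi').symm.trans (congrArg some h.symm)
    have h1 : Summable fun i : {i // (e i).isSome} =>
        ‖(hF i.1).toLp (F i.1)‖ ^ (2 : ENNReal).toReal := by
      refine Summable.of_nonneg_of_le (fun i => by positivity) (fun i => ?_)
        (hsum.comp_injective hinj)
      exact Real.rpow_le_rpow (norm_nonneg _) (hb i.1 _ (Option.some_get i.2).symm) (by norm_num)
    refine (Function.Injective.summable_iff (f := fun i =>
      ‖(hF i).toLp (F i)‖ ^ (2 : ENNReal).toReal)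
      (g := (Subtype.val : {i // (e i).isSome} → I)) Subtype.val_injective ?_).1 h1
    intro i hi
    have : e i = none := by
      by_contra h
      exact hi ⟨⟨i, Option.isSome_iff_ne_none.2 h⟩, rfl⟩
    simp only [hz i this]
    norm_num
  exact ⟨⟨_, hmem⟩, fun i => MemLp.coeFn_toLp (hF i)⟩

theorem HS.exists_of_ae_le (f : HS ν) (C : ℝ) (F : I → ℝ → ℂ)
    (hF : ∀ i, AEStronglyMeasurable (F i) (ν i))
    (h : ∀ i, ∀ᵐ t ∂(ν i), ‖F i t‖ ≤ C * ‖f i t‖) :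
    ∃ g : HS ν, ∀ i, ∀ᵐ t ∂(ν i), g i t = F i t := by
  have hm : ∀ i, MemLp (F i) 2 (ν i) := fun i => MemLp.of_le_mul (Lp.memLp (f i)) (hF i) (h i)
  refine HS.exists_of_memLp f some (fun i i' j h h' => ?_) C F hm (fun i hi => by simp at hi) ?_
  · simp only [Option.some.injEq] at h h'
    rw [h, h']
  · rintro i j hij
    obtain rfl : i = j := by simpa using hij
    refine (eLpNorm_le_mul_eLpNorm_of_ae_le_mul (h i) 2).trans ?_
    rw [ENNReal.ofReal_mul' (norm_nonneg _), Lp.norm_def,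
      ENNReal.ofReal_toReal (Lp.eLpNorm_ne_top _)]

theorem HS.norm_le_of_ae {f g : HS ν} (h : ∀ i, ∀ᵐ t ∂(ν i), ‖g i t‖ ≤ ‖f i t‖) :
    ‖g‖ ≤ ‖f‖ := by
  refine lp.norm_mono (by norm_num) fun i => ?_
  exact Lp.norm_le_norm_of_ae_le (h i)

/-- `g` is the image of `f` under componentwise multiplication by the real function `m`. -/
def IsMul (ν : I → Measure ℝ) (m : ℝ → ℝ) (f g : HS ν) : Prop :=
  ∀ i, ∀ᵐ t ∂(ν i), g i t = (m t : ℂ) * f i t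

theorem IsMul.exists_of_bounded (m : ℝ → ℝ) (hm : Measurable m) (C : ℝ) (hC : ∀ t, |m t| ≤ C)
    (f : HS ν) : ∃ g, IsMul ν m f g := by
  refine HS.exists_of_ae_le f C (fun i t => (m t : ℂ) * f i t) (fun i => ?_) (fun i => ?_)
  · exact (Complex.measurable_ofReal.comp hm).aestronglyMeasurable.mul
      (Lp.aestronglyMeasurable (f i))
  · refine Filter.Eventually.of_forall fun t => ?_
    rw [norm_mul, Complex.norm_real, Real.norm_eq_abs]
    gcongr
    exact hC t

theorem IsMul.inner_symm {m : ℝ → ℝ} {f f' g g' : HS ν} (hf : IsMul ν m f f')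
    (hg : IsMul ν m g g') : inner ℂ f' g = inner ℂ f g' := by
  refine HS.inner_congr_ae fun i => ?_
  filter_upwards [hf i, hg i] with t h1 h2
  rw [h1, h2]
  simp only [RCLike.inner_apply, map_mul, Complex.conj_ofReal]
  ring

theorem IsMul.add {m : ℝ → ℝ} {f f' g g' : HS ν} (hf : IsMul ν m f f') (hg : IsMul ν m g g') :
    IsMul ν m (f + g) (f' + g') := by
  intro i
  filter_upwards [hf i, hg i, HS.add_ae f g i, HS.add_ae f' g' i] with t h1 h2 h3 h4
  rw [h4, h3, h1, h2, mul_add]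

theorem IsMul.sub {m : ℝ → ℝ} {f f' g g' : HS ν} (hf : IsMul ν m f f') (hg : IsMul ν m g g') :
    IsMul ν m (f - g) (f' - g') := by
  intro i
  filter_upwards [hf i, hg i, HS.sub_ae f g i, HS.sub_ae f' g' i] with t h1 h2 h3 h4
  rw [h4, h3, h1, h2, mul_sub]

theorem IsMul.smul {m : ℝ → ℝ} {f f' : HS ν} (hf : IsMul ν m f f') (c : ℂ) :
    IsMul ν m (c • f) (c • f') := by
  intro i
  filter_upwards [hf i, HS.smul_ae c f i, HS.smul_ae c f' i] with t h1 h2 h3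
  rw [h3, h2, h1, mul_left_comm]

theorem IsMul.unique {m : ℝ → ℝ} {f g g' : HS ν} (h : IsMul ν m f g) (h' : IsMul ν m f g') :
    g = g' := by
  refine HS.ext_ae fun i => ?_
  filter_upwards [h i, h' i] with t h1 h2
  rw [h1, h2]

/-- Multiplication by `t⁻¹` is maximal: it is its own adjoint. -/
theorem IsMul.of_inner (h0 : ∀ i, ∀ᵐ t ∂(ν i), t ≠ 0) {k w : HS ν}
    (h : ∀ f f', IsMul ν (·⁻¹) f f' → inner ℂ w f = inner ℂ k f') : IsMul ν (·⁻¹) k w := by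
  have hpos : ∀ t : ℝ, 0 < 1 + |t| := fun t => by positivity
  have hm1 : Measurable fun t : ℝ => t / (1 + |t|) := by fun_prop
  have hm2 : Measurable fun t : ℝ => 1 / (1 + |t|) := by fun_prop
  have hb1 : ∀ t : ℝ, |t / (1 + |t|)| ≤ 1 := fun t => by
    rw [abs_div, abs_of_pos (hpos t), div_le_one (hpos t)]; linarith
  have hb2 : ∀ t : ℝ, |1 / (1 + |t|)| ≤ 1 := fun t => by
    rw [abs_div, abs_of_pos (hpos t), div_le_one (hpos t), abs_one]
    linarith [abs_nonneg t]
  obtain ⟨w', hw'⟩ := IsMul.exists_of_bounded _ hm1 1 hb1 w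
  obtain ⟨k', hk'⟩ := IsMul.exists_of_bounded _ hm2 1 hb2 k
  have key : w' = k' := by
    refine ext_inner_right ℂ fun φ => ?_
    obtain ⟨a, ha⟩ := IsMul.exists_of_bounded _ hm1 1 hb1 φ
    obtain ⟨b, hb⟩ := IsMul.exists_of_bounded _ hm2 1 hb2 φ
    rw [hw'.inner_symm ha, hk'.inner_symm hb]
    refine h a b fun i => ?_
    filter_upwards [ha i, hb i, h0 i] with t h1 h2 h3
    rw [h1, h2]
    have := (hpos t).ne'
    rw [← mul_assoc, ← Complex.ofReal_mul]
    congr 2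
    field_simp
  subst key
  intro i
  filter_upwards [hw' i, hk' i, h0 i] with t h1 h2 h3
  have h4 : ((1 + |t| : ℝ) : ℂ) ≠ 0 := by exact_mod_cast (hpos t).ne'
  have h5 : (t : ℂ) ≠ 0 := by exact_mod_cast h3
  rw [h1] at h2
  push_cast at h2 h4 ⊢
  field_simp at h2 ⊢
  exact h2

end DirectSum

section Shift

variable {I : Type*} {ν : I → Measure ℝ} {q : ℝ}

/-- The dilations `(S f)(t) = f(q⁻¹ t)` and `(S' f)(t) = f(q t)`, bounded on `⊕ L²(ν i)`, when the
measures `ν i` are homogeneous: `ν i (q M) = q ν i (M)`. -/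
structure IsDilation (q : ℝ) (ν : I → Measure ℝ) (S S' : HS ν →L[ℂ] HS ν) : Prop where
  pos : 0 < q
  lt_one : q < 1
  ae_ne_zero : ∀ i, ∀ᵐ t ∂(ν i), t ≠ 0
  ae_mul : ∀ i, ∀ p : ℝ → Prop, (∀ᵐ t ∂(ν i), p t) → ∀ᵐ t ∂(ν i), p (q * t)
  ae_inv_mul : ∀ i, ∀ p : ℝ → Prop, (∀ᵐ t ∂(ν i), p t) → ∀ᵐ t ∂(ν i), p (q⁻¹ * t)
  left_ae : ∀ f i, ∀ᵐ t ∂(ν i), S f i t = f i (q⁻¹ * t)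
  right_ae : ∀ f i, ∀ᵐ t ∂(ν i), S' f i t = f i (q * t)
  inner_left : ∀ f g, inner ℂ (S f) g = (q : ℂ) * inner ℂ f (S' g)

namespace IsDilation

variable {S S' : HS ν →L[ℂ] HS ν}

theorem left_right (h : IsDilation q ν S S') (f : HS ν) : S (S' f) = f := by
  refine HS.ext_ae fun i => ?_
  filter_upwards [h.left_ae (S' f) i, h.ae_inv_mul i _ (h.right_ae f i)] with t h1 h2
  rw [h1, h2, mul_inv_cancel_left₀ h.pos.ne']

theorem right_left (h : IsDilation q ν S S') (f : HS ν) : S' (S f) = f := by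
  refine HS.ext_ae fun i => ?_
  filter_upwards [h.right_ae (S f) i, h.ae_mul i _ (h.left_ae f i)] with t h1 h2
  rw [h1, h2, inv_mul_cancel_left₀ h.pos.ne']

theorem inner_right (h : IsDilation q ν S S') (f g : HS ν) :
    inner ℂ f (S g) = (q : ℂ) * inner ℂ (S' f) g := by
  rw [← inner_conj_symm, h.inner_left, map_mul, Complex.conj_ofReal, inner_conj_symm]

theorem norm_sq_left (h : IsDilation q ν S S') (f : HS ν) : ‖S f‖ ^ 2 = q * ‖f‖ ^ 2 := by
  have := h.inner_left f (S f)
  rw [h.right_left, inner_self_eq_norm_sq_to_K, inner_self_eq_norm_sq_to_K] at this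
  apply Complex.ofReal_injective
  push_cast
  exact this

theorem norm_left_left (h : IsDilation q ν S S') (f : HS ν) : ‖S (S f)‖ = q * ‖f‖ := by
  have h1 := h.norm_sq_left (S f)
  rw [h.norm_sq_left f] at h1
  have hq := h.pos
  rw [← abs_of_nonneg (norm_nonneg (S (S f))), ← abs_of_nonneg (by positivity : 0 ≤ q * ‖f‖)]
  rw [← sq_eq_sq_iff_abs_eq_abs, h1]
  ring

theorem norm_right_right (h : IsDilation q ν S S') (f : HS ν) :
    ‖S' (S' f)‖ = q⁻¹ * ‖f‖ := by
  have h1 := h.norm_left_left (S' (S' f))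
  rw [h.left_right, h.left_right] at h1
  rw [h1, inv_mul_cancel_left₀ h.pos.ne']

theorem left_left_ae (h : IsDilation q ν S S') (f : HS ν) (i : I) :
    ∀ᵐ t ∂(ν i), S (S f) i t = f i (q⁻¹ * (q⁻¹ * t)) := by
  filter_upwards [h.left_ae (S f) i, h.ae_inv_mul i _ (h.left_ae f i)] with t h1 h2
  rw [h1, h2]

theorem right_right_ae (h : IsDilation q ν S S') (f : HS ν) (i : I) :
    ∀ᵐ t ∂(ν i), S' (S' f) i t = f i (q * (q * t)) := by
  filter_upwards [h.right_ae (S' f) i, h.ae_mul i _ (h.right_ae f i)] with t h1 h2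
  rw [h1, h2]

theorem isMul_left (h : IsDilation q ν S S') {f f' : HS ν} (hf : IsMul ν (·⁻¹) f f') :
    IsMul ν (·⁻¹) (S f) ((q⁻¹ : ℂ) • S f') := by
  intro i
  have hq : (q : ℂ) ≠ 0 := by exact_mod_cast h.pos.ne'
  filter_upwards [h.left_ae f i, h.left_ae f' i, h.ae_inv_mul i _ (hf i),
    HS.smul_ae (q⁻¹ : ℂ) (S f') i] with t h1 h2 h3 h4
  rw [h4, h1, h2, h3]
  push_cast
  field_simp

theorem isMul_right (h : IsDilation q ν S S') {f f' : HS ν} (hf : IsMul ν (·⁻¹) f f') :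
    IsMul ν (·⁻¹) (S' f) ((q : ℂ) • S' f') := by
  intro i
  have hq : (q : ℂ) ≠ 0 := by exact_mod_cast h.pos.ne'
  filter_upwards [h.right_ae f i, h.right_ae f' i, h.ae_mul i _ (hf i),
    HS.smul_ae (q : ℂ) (S' f') i] with t h1 h2 h3 h4
  rw [h4, h1, h2, h3]
  push_cast
  field_simp

theorem eq_of_sub_left_left (h : IsDilation q ν S S') {v v' : HS ν}
    (hv : v - S (S v) = v' - S (S v')) : v = v' := by
  have h1 : v - v' = S (S (v - v')) := by
    rw [map_sub, map_sub, sub_eq_sub_iff_add_eq_add]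
    rw [sub_eq_sub_iff_add_eq_add] at hv
    rw [hv]; abel
  have h2 := h.norm_left_left (v - v')
  rw [← h1] at h2
  have h3 : ‖v - v'‖ = 0 := by nlinarith [h.lt_one, norm_nonneg (v - v')]
  exact sub_eq_zero.1 (norm_eq_zero.1 h3)

theorem exists_sub_eq {H : Type*} [NormedAddCommGroup H] [NormedSpace ℂ H]
    [CompleteSpace H] (R : H →L[ℂ] H) {c : ℝ} (hc0 : 0 ≤ c) (hc : c < 1)
    (hR : ∀ x, ‖R x‖ ≤ c * ‖x‖) (z : H) : ∃ v, v - R v = z := by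
  have hn : ‖R‖ < 1 := (R.opNorm_le_bound hc0 hR).trans_lt hc
  obtain ⟨u, hu⟩ := isUnit_one_sub_of_norm_lt_one hn
  refine ⟨(↑u⁻¹ : H →L[ℂ] H) z, ?_⟩
  have := congrArg (fun A : H →L[ℂ] H => A z) u.mul_inv
  rw [hu] at this
  simpa using this

theorem exists_sub_left_left (h : IsDilation q ν S S') (z : HS ν) :
    ∃ v, v - S (S v) = z :=
  exists_sub_eq (S ∘L S) h.pos.le h.lt_one (fun x => (h.norm_left_left x).le) z

/-- A solution of `v - S² v = z` vanishes outside the unit ball if `z` does. -/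
theorem ae_eq_zero (h : IsDilation q ν S S') {v z : HS ν} (hv : v - S (S v) = z)
    (hz : ∀ i, ∀ᵐ t ∂(ν i), 1 ≤ |t| → z i t = 0) : ∀ i, ∀ᵐ t ∂(ν i), 1 ≤ |t| → v i t = 0 := by
  have hm : Measurable (Set.indicator {t : ℝ | 1 ≤ |t|} (fun _ => (1 : ℝ))) :=
    measurable_const.indicator (measurableSet_le measurable_const measurable_norm)
  have hb : ∀ t, |Set.indicator {t : ℝ | 1 ≤ |t|} (fun _ => (1 : ℝ)) t| ≤ 1 := fun t => by
    by_cases ht : 1 ≤ |t| <;> simp [ht]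
  obtain ⟨w, hw⟩ := IsMul.exists_of_bounded _ hm 1 hb v
  have hq := h.pos
  have h1 : ‖w‖ ≤ ‖S (S w)‖ := by
    refine HS.norm_le_of_ae fun i => ?_
    filter_upwards [hw i, h.left_left_ae v i, h.left_left_ae w i, HS.sub_ae v (S (S v)) i, hz i,
      h.ae_inv_mul i _ (h.ae_inv_mul i _ (hw i))] with t h1 h2 h3 h4 h5 h6
    rw [h1, h3, h6]
    by_cases ht : 1 ≤ |t|
    · rw [hv, h5 ht, h2] at h4
      have hqi : 1 ≤ q⁻¹ := (one_le_inv₀ hq).2 h.lt_one.le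
      have ht' : 1 ≤ |q⁻¹ * (q⁻¹ * t)| := by
        rw [abs_mul, abs_mul, abs_of_pos (inv_pos.2 hq)]
        have : 1 ≤ q⁻¹ * |t| := by nlinarith
        nlinarith
      rw [Set.indicator_of_mem (by exact ht), Set.indicator_of_mem (by exact ht'),
        sub_eq_zero.1 h4.symm]
    · rw [Set.indicator_of_notMem (by exact ht), Complex.ofReal_zero, zero_mul, norm_zero]
      exact norm_nonneg _
  rw [h.norm_left_left] at h1
  have h3 : ‖w‖ = 0 := by nlinarith [h.lt_one, norm_nonneg w]
  rw [norm_eq_zero] at h3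
  subst h3
  intro i
  filter_upwards [hw i, HS.zero_ae i] with t h1 h2 ht
  rw [h2, Set.indicator_of_mem (by exact ht)] at h1
  simpa using h1.symm

/-- Decomposition of an element of the domain of the adjoint into a regular part and two boundary
parts. -/
theorem exists_decomposition (h : IsDilation q ν S S') {g w : HS ν}
    (hg : IsMul ν (·⁻¹) (S g - S' g) w) :
    ∃ p p' ve vo : HS ν, IsMul ν (·⁻¹) p p' ∧
      (∀ i, ∀ᵐ t ∂(ν i), |t| ∉ Set.Ico q 1 → (ve - S (S ve)) i t = 0) ∧
      (∀ i, ∀ᵐ t ∂(ν i), |t| ∉ Set.Ico q 1 → (vo - S (S vo)) i t = 0) ∧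
      g = p + ve + S vo := by
  have hq := h.pos
  have hqi : 1 < q⁻¹ := (one_lt_inv₀ hq).2 h.lt_one
  have hqc : (q : ℂ) ≠ 0 := by exact_mod_cast hq.ne'
  obtain ⟨w1, hw1⟩ : ∃ w1, IsMul ν (·⁻¹) (g - S (S g)) w1 := by
    refine ⟨-1 • ((q⁻¹ : ℂ) • S w), ?_⟩
    have := (h.isMul_left hg).smul (-1)
    rw [map_sub, h.left_right] at this
    convert this using 1
    · simp
    · simp
  obtain ⟨r, hr⟩ := exists_sub_eq ((q ^ 2 : ℂ) • (S' ∘L S')) hq.le h.lt_one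
    (fun x => by
      rw [smul_apply, norm_smul, ContinuousLinearMap.comp_apply,
        h.norm_right_right, norm_pow, Complex.norm_real, Real.norm_eq_abs, abs_of_pos hq]
      apply le_of_eq
      field_simp) (-((q ^ 2 : ℂ) • S' (S' w1)))
  have hr' : ∀ i, ∀ᵐ t ∂(ν i),
      r i t = q ^ 2 * (r i (q * (q * t)) - w1 i (q * (q * t))) := by
    intro i
    have e : r = (q ^ 2 : ℂ) • S' (S' (r - w1)) := by
      rw [sub_eq_iff_eq_add] at hr
      rw [map_sub, map_sub, smul_sub]
      conv_lhs => rw [hr]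
      simp only [smul_apply, ContinuousLinearMap.comp_apply]
      abel
    have e1 := HS.smul_ae (q ^ 2 : ℂ) (S' (S' (r - w1))) i
    rw [← e] at e1
    filter_upwards [e1, h.right_right_ae (r - w1) i,
      h.ae_mul i _ (h.ae_mul i _ (HS.sub_ae r w1 i))] with t h1 h2 h3
    rw [h1, h2, h3]
  have hB : MeasurableSet {t : ℝ | |t| < 1} := measurableSet_lt measurable_norm measurable_const
  have hbi : ∀ t, |Set.indicator {t : ℝ | |t| < 1} (fun _ => (1 : ℝ)) t| ≤ 1 := fun t => by
    by_cases ht : |t| < 1 <;> simp [ht]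
  have hbt : ∀ t, |Set.indicator {t : ℝ | |t| < 1} (fun t => t) t| ≤ 1 := fun t => by
    by_cases ht : |t| < 1
    · rw [Set.indicator_of_mem (by exact ht)]; exact ht.le
    · rw [Set.indicator_of_notMem (by exact ht)]; simp
  have hbc : ∀ t, |Set.indicator {t : ℝ | |t| < 1}ᶜ (fun t => t⁻¹) t| ≤ 1 := fun t => by
    by_cases ht : |t| < 1
    · rw [Set.indicator_of_notMem (by simpa using ht)]; simp
    · rw [Set.indicator_of_mem (by exact ht), abs_inv]
      exact inv_le_one_of_one_le₀ (not_lt.1 ht)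
  obtain ⟨g1, hg1⟩ := IsMul.exists_of_bounded _ (measurable_const.indicator hB) 1 hbi g
  obtain ⟨r1, hr1⟩ := IsMul.exists_of_bounded _ (measurable_const.indicator hB) 1 hbi r
  obtain ⟨r2, hr2⟩ := IsMul.exists_of_bounded _ (measurable_id'.indicator hB) 1 hbt r
  obtain ⟨g2, hg2⟩ := IsMul.exists_of_bounded _ (measurable_inv.indicator hB.compl) 1 hbc g
  have hp : IsMul ν (·⁻¹) (g - (g1 - r2)) (g2 + r1) := by
    intro i
    filter_upwards [hg1 i, hr1 i, hr2 i, hg2 i, HS.sub_ae g1 r2 i, HS.sub_ae g (g1 - r2) i,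
      HS.add_ae g2 r1 i, h.ae_ne_zero i] with t h1 h2 h3 h4 h5 h6 h7 h8
    rw [h7, h6, h5, h1, h2, h3, h4]
    have h9 : (t : ℂ) ≠ 0 := by exact_mod_cast h8
    by_cases ht : |t| < 1
    · rw [Set.indicator_of_notMem (by simpa using ht), Set.indicator_of_mem (by exact ht),
        Set.indicator_of_mem (by exact ht)]
      push_cast
      field_simp
      ring
    · rw [Set.indicator_of_mem (by simpa using ht), Set.indicator_of_notMem (by exact ht),
        Set.indicator_of_notMem (by exact ht)]
      push_cast
      ring
  have hz : ∀ i, ∀ᵐ t ∂(ν i), |t| ∉ Set.Ico (q * q) 1 →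
      ((g1 - r2) - S (S (g1 - r2))) i t = 0 := by
    intro i
    filter_upwards [HS.sub_ae (g1 - r2) (S (S (g1 - r2))) i, h.left_left_ae (g1 - r2) i,
      HS.sub_ae g1 r2 i, h.ae_inv_mul i _ (h.ae_inv_mul i _ (HS.sub_ae g1 r2 i)), hg1 i,
      h.ae_inv_mul i _ (h.ae_inv_mul i _ (hg1 i)), hr2 i,
      h.ae_inv_mul i _ (h.ae_inv_mul i _ (hr2 i)),
      h.ae_inv_mul i _ (h.ae_inv_mul i _ (hr' i)), hw1 i, HS.sub_ae g (S (S g)) i,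
      h.left_left_ae g i, h.ae_ne_zero i] with t h1 h2 h3 h4 h5 h6 h7 h8 h9 h10 h11 h12 h13 ht
    have h14 : (t : ℂ) ≠ 0 := by exact_mod_cast h13
    have habs : |q⁻¹ * (q⁻¹ * t)| = q⁻¹ * (q⁻¹ * |t|) := by
      rw [abs_mul, abs_mul, abs_of_pos (inv_pos.2 hq)]
    rw [h1, h2, h3, h4, h5, h6, h7, h8]
    rcases lt_or_ge |t| (q * q) with htq | htq
    · have ht1 : |t| < 1 := htq.trans (by nlinarith [h.lt_one])
      have ht2 : |q⁻¹ * (q⁻¹ * t)| < 1 := by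
        rw [habs, inv_mul_lt_iff₀ hq, inv_mul_lt_iff₀ hq]
        simpa using htq
      simp only [Set.indicator_of_mem (show t ∈ {t : ℝ | |t| < 1} from ht1),
        Set.indicator_of_mem (show q⁻¹ * (q⁻¹ * t) ∈ {t : ℝ | |t| < 1} from ht2)]
      rw [h11, h12] at h10
      rw [mul_inv_cancel_left₀ hq.ne', mul_inv_cancel_left₀ hq.ne'] at h9
      rw [h9]
      push_cast at h10 ⊢
      rw [h10]
      field_simp
      ring
    · have ht1 : ¬ |t| < 1 := fun h' => ht ⟨htq, h'⟩
      have ht2 : ¬ |q⁻¹ * (q⁻¹ * t)| < 1 := by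
        rw [habs]
        have : 1 ≤ q⁻¹ * |t| := by nlinarith
        nlinarith
      simp only [Set.indicator_of_notMem (show t ∉ {t : ℝ | |t| < 1} from ht1),
        Set.indicator_of_notMem (show q⁻¹ * (q⁻¹ * t) ∉ {t : ℝ | |t| < 1} from ht2)]
      simp
  have hA : MeasurableSet {t : ℝ | q ≤ |t|} := measurableSet_le measurable_const measurable_norm
  have hbA : ∀ t, |Set.indicator {t : ℝ | q ≤ |t|} (fun _ => (1 : ℝ)) t| ≤ 1 := fun t => by
    by_cases ht : q ≤ |t| <;> simp [ht]
  obtain ⟨z0, hz0⟩ := IsMul.exists_of_bounded _ (measurable_const.indicator hA) 1 hbA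
    ((g1 - r2) - S (S (g1 - r2)))
  obtain ⟨v0, hv0⟩ := h.exists_sub_left_left z0
  obtain ⟨v1, hv1⟩ := h.exists_sub_left_left (S' ((g1 - r2) - S (S (g1 - r2)) - z0))
  have hfin : g1 - r2 = v0 + S v1 := by
    refine h.eq_of_sub_left_left ?_
    have e := congrArg S hv1
    rw [h.left_right, map_sub] at e
    rw [map_add, map_add, add_sub_add_comm, hv0, e]
    abel
  refine ⟨_, _, v0, v1, hp, ?_, ?_, ?_⟩
  · rw [hv0]
    intro i
    filter_upwards [hz0 i, hz i] with t h1 h2 ht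
    rw [h1]
    by_cases hqt : q ≤ |t|
    · rw [h2, mul_zero]
      exact fun h' => ht ⟨hqt, h'.2⟩
    · rw [Set.indicator_of_notMem (by exact hqt)]
      simp
  · rw [hv1]
    intro i
    filter_upwards [h.right_ae ((g1 - r2) - S (S (g1 - r2)) - z0) i,
      h.ae_mul i _ (HS.sub_ae ((g1 - r2) - S (S (g1 - r2))) z0 i), h.ae_mul i _ (hz0 i),
      h.ae_mul i _ (hz i)] with t h1 h2 h3 h4 ht
    rw [h1, h2, h3]
    have habs : |q * t| = q * |t| := by rw [abs_mul, abs_of_pos hq]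
    by_cases hqt : q ≤ |q * t|
    · rw [Set.indicator_of_mem (by exact hqt)]
      simp
    · rw [h4, mul_zero, sub_zero]
      rw [habs] at hqt ⊢
      rintro ⟨h5, h6⟩
      exact ht ⟨le_of_mul_le_mul_left h5 hq, by nlinarith⟩
  · rw [add_assoc, ← hfin]
    abel

end IsDilation

end Shift

section Induced

variable {q ε : ℝ} {μ1 μ : Measure ℝ}

/-- The measure `μ` on the half-line `εℝ₊` is induced by the measure `μ₁` on `[q,1)`. -/
structure IsInduced (q ε : ℝ) (μ1 μ : Measure ℝ) : Prop where
  pos : 0 < q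
  lt_one : q < 1
  sign : ε * ε = 1
  ae_mem : ∀ᵐ s ∂μ1, s ∈ Set.Ico q 1
  eq_sum : μ = Measure.sum fun n : ℤ =>
    ENNReal.ofReal (q ^ n) • μ1.map (fun s => (ε * q ^ n) * s)

theorem zpow_eq_of_mem_Ico (hq0 : 0 < q) (hq1 : q < 1) {m n : ℤ} {s t : ℝ}
    (hs : s ∈ Set.Ico q 1) (ht : t ∈ Set.Ico q 1) (h : q ^ m * s = q ^ n * t) : m = n := by
  have key : ∀ {m n : ℤ} {s t : ℝ}, s ∈ Set.Ico q 1 → t ∈ Set.Ico q 1 →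
      q ^ m * s = q ^ n * t → ¬ m < n := by
    intro m n s t hs ht h hmn
    have h1 : q ^ n ≤ q ^ (m + 1) :=
      zpow_le_zpow_right_of_le_one₀ hq0 hq1.le (by omega)
    rw [zpow_add_one₀ hq0.ne'] at h1
    have h2 : 0 < q ^ m := zpow_pos hq0 m
    have h3 : 0 < q ^ n := zpow_pos hq0 n
    have h4 : q ^ m * q ≤ q ^ m * s := by gcongr; exact hs.1
    have h5 : q ^ n * t < q ^ n * 1 := by gcongr; exact ht.2
    linarith
  exact le_antisymm (not_lt.1 (key ht hs h.symm)) (not_lt.1 (key hs ht h))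

theorem exists_zpow_mul_mem_Ico (hq0 : 0 < q) (hq1 : q < 1) {t : ℝ} (ht : 0 < t) :
    ∃ n : ℤ, ∃ s ∈ Set.Ico q 1, t = q ^ n * s := by
  obtain ⟨n, h1, h2⟩ := exists_mem_Ico_zpow (inv_pos.2 ht) ((one_lt_inv₀ hq0).2 hq1)
  have h0 : 0 < q ^ n := zpow_pos hq0 n
  rw [inv_zpow] at h1
  rw [inv_zpow, zpow_add_one₀ hq0.ne'] at h2
  rw [inv_le_inv₀ h0 ht] at h1
  rw [inv_lt_inv₀ ht (by positivity)] at h2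
  rcases h1.lt_or_eq with h1 | h1
  · refine ⟨n, (q ^ n)⁻¹ * t, ⟨?_, ?_⟩, by field_simp⟩
    · rw [le_inv_mul_iff₀ h0]; exact h2.le
    · rw [inv_mul_lt_iff₀ h0]; linarith
  · refine ⟨n - 1, q, ⟨le_rfl, hq1⟩, ?_⟩
    rw [h1, zpow_sub_one₀ hq0.ne']
    field_simp

theorem IsInduced.of_image (hq0 : 0 < q) (hq1 : q < 1) (hε : ε * ε = 1)
    (hs : μ1 (Set.Ico q 1)ᶜ = 0) (h0 : ∀ᵐ t ∂μ, 0 < ε * t)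
    (h : ∀ M : Set ℝ, MeasurableSet M → M ⊆ Set.Ico q 1 → ∀ n : ℤ,
      μ ((fun t => (ε * q ^ n) * t) '' M) = ENNReal.ofReal (q ^ n) * μ1 M) :
    IsInduced q ε μ1 μ := by
  have hε0 : ε ≠ 0 := by rintro rfl; simp at hε
  have hne : ∀ n : ℤ, ε * q ^ n ≠ 0 := fun n => mul_ne_zero hε0 (zpow_ne_zero _ hq0.ne')
  have hae : ∀ᵐ s ∂μ1, s ∈ Set.Ico q 1 := hs
  refine ⟨hq0, hq1, hε, hae, ?_⟩
  ext M hM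
  rw [Measure.sum_apply _ hM]
  have hmeas : ∀ n : ℤ, MeasurableSet ((fun s => (ε * q ^ n) * s) ⁻¹' M ∩ Set.Ico q 1) :=
    fun n => ((measurable_const_mul _) hM).inter measurableSet_Ico
  have h1 : ∀ n : ℤ, (ENNReal.ofReal (q ^ n) • μ1.map (fun s => (ε * q ^ n) * s)) M =
      μ ((fun t => (ε * q ^ n) * t) '' ((fun s => (ε * q ^ n) * s) ⁻¹' M ∩ Set.Ico q 1)) := by
    intro n
    rw [h _ (hmeas n) Set.inter_subset_right, Measure.smul_apply, smul_eq_mul,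
      Measure.map_apply (measurable_const_mul _) hM]
    congr 1
    refine measure_congr ?_
    filter_upwards [hae] with s hs
    apply propext
    exact ⟨fun h => ⟨h, hs⟩, fun h => h.1⟩
  simp only [h1]
  rw [← measure_iUnion]
  · refine measure_congr ?_
    filter_upwards [h0] with t ht
    apply propext
    constructor
    · intro htM
      obtain ⟨n, s, hs, hn⟩ := exists_zpow_mul_mem_Ico hq0 hq1 ht
      have e : ε * q ^ n * s = t := by
        rw [mul_assoc, ← hn, ← mul_assoc, hε, one_mul]
      refine Set.mem_iUnion.2 ⟨n, s, ⟨?_, hs⟩, e⟩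
      change ε * q ^ n * s ∈ M
      rwa [e]
    · intro h
      obtain ⟨n, s, ⟨hs, -⟩, rfl⟩ := Set.mem_iUnion.1 h
      exact hs
  · intro m n hmn
    rw [Function.onFun, Set.disjoint_left]
    rintro t ⟨s, ⟨-, hs⟩, hs'⟩ ⟨r, ⟨-, hr⟩, hr'⟩
    refine hmn (zpow_eq_of_mem_Ico hq0 hq1 hs hr (mul_left_cancel₀ hε0 ?_))
    simp only at hs' hr'
    rw [← mul_assoc, ← mul_assoc, hs', hr']
  · exact fun n => (measurableEmbedding_mulLeft₀ (hne n)).measurableSet_image.2 (hmeas n)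

namespace IsInduced

theorem sign_ne_zero (h : IsInduced q ε μ1 μ) : ε ≠ 0 := by
  rintro rfl
  simpa using h.sign

theorem ae_iff (h : IsInduced q ε μ1 μ) {p : ℝ → Prop} :
    (∀ᵐ t ∂μ, p t) ↔ ∀ n : ℤ, ∀ᵐ s ∂μ1, p ((ε * q ^ n) * s) := by
  rw [h.eq_sum, Measure.ae_sum_iff]
  refine forall_congr' fun n => ?_
  have h1 : ENNReal.ofReal (q ^ n) ≠ 0 := by
    simpa using zpow_pos h.pos n
  have h2 : (∀ᵐ t ∂(ENNReal.ofReal (q ^ n) • μ1.map (fun s => (ε * q ^ n) * s)), p t) ↔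
      ∀ᵐ t ∂(μ1.map (fun s => (ε * q ^ n) * s)), p t := by
    rw [MeasureTheory.ae_iff, MeasureTheory.ae_iff, Measure.smul_apply, smul_eq_mul, mul_eq_zero]
    simp [h1]
  rw [h2, MeasurableEmbedding.ae_map_iff (measurableEmbedding_mulLeft₀
    (mul_ne_zero h.sign_ne_zero (zpow_ne_zero _ h.pos.ne')))]

theorem ae_mul (h : IsInduced q ε μ1 μ) {p : ℝ → Prop} (hp : ∀ᵐ t ∂μ, p t) :
    ∀ᵐ t ∂μ, p (q * t) := by
  rw [h.ae_iff] at hp ⊢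
  intro n
  filter_upwards [hp (n + 1)] with s hs
  rw [zpow_add_one₀ h.pos.ne'] at hs
  convert hs using 1
  ring

theorem ae_inv_mul (h : IsInduced q ε μ1 μ) {p : ℝ → Prop} (hp : ∀ᵐ t ∂μ, p t) :
    ∀ᵐ t ∂μ, p (q⁻¹ * t) := by
  rw [h.ae_iff] at hp ⊢
  intro n
  filter_upwards [hp (n - 1)] with s hs
  rw [zpow_sub_one₀ h.pos.ne'] at hs
  convert hs using 1
  ring

theorem sign_mul_sign_mul (h : IsInduced q ε μ1 μ) (t : ℝ) : ε * (ε * t) = t := by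
  rw [← mul_assoc, h.sign, one_mul]

theorem ae_pos (h : IsInduced q ε μ1 μ) : ∀ᵐ t ∂μ, 0 < ε * t := by
  rw [h.ae_iff]
  intro n
  filter_upwards [h.ae_mem] with s hs
  rw [mul_assoc, h.sign_mul_sign_mul]
  exact mul_pos (zpow_pos h.pos n) (h.pos.trans_le hs.1)

theorem ae_abs (h : IsInduced q ε μ1 μ) : ∀ᵐ t ∂μ, |t| = ε * t := by
  filter_upwards [h.ae_pos] with t ht
  have h1 : |ε| = 1 := by
    have := h.sign
    rw [← abs_mul_abs_self] at this
    nlinarith [abs_nonneg ε]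
  rw [← abs_of_pos ht, abs_mul, h1, one_mul]

theorem ae_wd_iff (h : IsInduced q ε μ1 μ) {p : ℝ → Prop} :
    (∀ᵐ s ∂(wd μ1), p s) ↔ ∀ᵐ s ∂μ1, p s := by
  rw [wd, ae_withDensity_iff (by fun_prop)]
  refine Filter.eventually_congr ?_
  filter_upwards [h.ae_mem] with s hs
  have : 0 < s := h.pos.trans_le hs.1
  simp [this]

theorem ae_of_ae_wd (h : IsInduced q ε μ1 μ) {p : ℝ → Prop} (hp : ∀ᵐ s ∂(wd μ1), p s) :
    ∀ᵐ t ∂μ, ε * t ∈ Set.Ico q 1 → p (ε * t) := by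
  rw [h.ae_wd_iff] at hp
  rw [h.ae_iff]
  intro n
  filter_upwards [hp, h.ae_mem] with s h1 h2 h3
  rw [mul_assoc, h.sign_mul_sign_mul] at h3 ⊢
  have : (0 : ℤ) = n := zpow_eq_of_mem_Ico h.pos h.lt_one h3 h2 (by simp)
  subst this
  simpa using h1

theorem restrict_eq_map (h : IsInduced q ε μ1 μ) :
    μ.restrict ((fun t => ε * t) ⁻¹' Set.Ico q 1) = μ1.map (fun s => ε * s) := by
  have hA : MeasurableSet ((fun t => ε * t) ⁻¹' Set.Ico q 1) :=
    (measurable_const_mul ε) measurableSet_Ico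
  ext M hM
  rw [Measure.restrict_apply hM, h.eq_sum, Measure.sum_apply _ (hM.inter hA), tsum_eq_single 0]
  · simp only [zpow_zero, ENNReal.ofReal_one, one_smul, mul_one]
    rw [Measure.map_apply (measurable_const_mul _) (hM.inter hA),
      Measure.map_apply (measurable_const_mul _) hM]
    refine measure_congr ?_
    filter_upwards [h.ae_mem] with s hs
    apply propext
    refine ⟨fun h => h.1, fun h' => ⟨h', ?_⟩⟩
    change ε * (ε * s) ∈ Set.Ico q 1
    rwa [h.sign_mul_sign_mul]
  · intro n hn
    rw [Measure.smul_apply, Measure.map_apply (measurable_const_mul _) (hM.inter hA)]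
    have : ∀ᵐ s ∂μ1, s ∉ (fun s => ε * q ^ n * s) ⁻¹' (M ∩ (fun t => ε * t) ⁻¹' Set.Ico q 1) := by
      filter_upwards [h.ae_mem] with s hs h'
      have h2 : ε * (ε * q ^ n * s) ∈ Set.Ico q 1 := h'.2
      rw [mul_assoc, h.sign_mul_sign_mul] at h2
      exact hn (zpow_eq_of_mem_Ico h.pos h.lt_one hs h2 (by simp))
    rw [measure_eq_zero_iff_ae_notMem.2 this, smul_zero]

theorem le_wd (h : IsInduced q ε μ1 μ) : μ1 ≤ wd μ1 := by
  conv_lhs => rw [← withDensity_one (μ := μ1)]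
  refine withDensity_mono ?_
  filter_upwards [h.ae_mem] with s hs
  have : 0 < s := h.pos.trans_le hs.1
  rw [Pi.one_apply, ← ENNReal.ofReal_one]
  exact ENNReal.ofReal_le_ofReal ((one_le_inv₀ this).2 hs.2.le)

theorem wd_le (h : IsInduced q ε μ1 μ) : wd μ1 ≤ ENNReal.ofReal q⁻¹ • μ1 := by
  rw [← withDensity_const]
  refine withDensity_mono ?_
  filter_upwards [h.ae_mem] with s hs
  have : 0 < s := h.pos.trans_le hs.1
  exact ENNReal.ofReal_le_ofReal (inv_anti₀ h.pos hs.1)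

theorem measurableEmbedding (h : IsInduced q ε μ1 μ) :
    MeasurableEmbedding (fun s : ℝ => ε * s) :=
  measurableEmbedding_mulLeft₀ h.sign_ne_zero

theorem indicator_comp (b : ℝ → ℂ) :
    (fun t => Set.indicator (Set.Ico q 1) b (ε * t)) =
      Set.indicator ((fun t => ε * t) ⁻¹' Set.Ico q 1) (fun t => b (ε * t)) := by
  funext t
  by_cases ht : ε * t ∈ Set.Ico q 1
  · rw [Set.indicator_of_mem ht, Set.indicator_of_mem (by exact ht)]
  · rw [Set.indicator_of_notMem ht, Set.indicator_of_notMem (by exact ht)]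

theorem eLpNorm_indicator (h : IsInduced q ε μ1 μ) (b : ℝ → ℂ) :
    eLpNorm (fun t => Set.indicator (Set.Ico q 1) b (ε * t)) 2 μ = eLpNorm b 2 μ1 := by
  rw [indicator_comp, eLpNorm_indicator_eq_eLpNorm_restrict
    ((measurable_const_mul ε) measurableSet_Ico), h.restrict_eq_map,
    h.measurableEmbedding.eLpNorm_map_measure]
  congr 1
  funext s
  simp [h.sign_mul_sign_mul]

theorem memLp_indicator (h : IsInduced q ε μ1 μ) {b : ℝ → ℂ} (hb : MemLp b 2 μ1) :
    MemLp (fun t => Set.indicator (Set.Ico q 1) b (ε * t)) 2 μ := by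
  rw [indicator_comp, memLp_indicator_iff_restrict
    ((measurable_const_mul ε) measurableSet_Ico), h.restrict_eq_map,
    h.measurableEmbedding.memLp_map_measure_iff]
  convert hb using 1
  funext s
  simp [h.sign_mul_sign_mul]

theorem memLp_extend (h : IsInduced q ε μ1 μ) (b : Lp ℂ 2 (wd μ1)) :
    MemLp (fun t => Set.indicator (Set.Ico q 1) b (ε * t)) 2 μ :=
  h.memLp_indicator ((Lp.memLp b).mono_measure h.le_wd)

theorem eLpNorm_extend_le (h : IsInduced q ε μ1 μ) (b : Lp ℂ 2 (wd μ1)) :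
    eLpNorm (fun t => Set.indicator (Set.Ico q 1) b (ε * t)) 2 μ ≤ ENNReal.ofReal (1 * ‖b‖) := by
  rw [h.eLpNorm_indicator, one_mul, Lp.norm_def, ENNReal.ofReal_toReal (Lp.eLpNorm_ne_top _)]
  exact eLpNorm_mono_measure _ h.le_wd

theorem map_le (h : IsInduced q ε μ1 μ) : μ1.map (fun s => ε * s) ≤ μ := by
  rw [← h.restrict_eq_map]
  exact Measure.restrict_le_self

theorem memLp_trace (h : IsInduced q ε μ1 μ) (z : Lp ℂ 2 μ) :
    MemLp (fun s => z (ε * s)) 2 (wd μ1) := by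
  refine MemLp.mono_measure h.wd_le (MemLp.smul_measure ?_ ENNReal.ofReal_ne_top)
  exact h.measurableEmbedding.memLp_map_measure_iff.1 ((Lp.memLp z).mono_measure h.map_le)

theorem eLpNorm_trace_le (h : IsInduced q ε μ1 μ) (z : Lp ℂ 2 μ) :
    eLpNorm (fun s => z (ε * s)) 2 (wd μ1) ≤
      ENNReal.ofReal ((q⁻¹) ^ ((1 : ℝ) / 2) * ‖z‖) := by
  refine (eLpNorm_mono_measure _ h.wd_le).trans ?_
  rw [eLpNorm_smul_measure_of_ne_top (by norm_num), smul_eq_mul,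
    ENNReal.ofReal_mul (Real.rpow_nonneg (inv_nonneg.2 h.pos.le) _), Lp.norm_def,
    ENNReal.ofReal_toReal (Lp.eLpNorm_ne_top _)]
  refine mul_le_mul' ?_ ?_
  · rw [ENNReal.ofReal_rpow_of_nonneg (inv_nonneg.2 h.pos.le) (by norm_num)]
    norm_num
  · have := eLpNorm_mono_measure z (p := 2) h.map_le
    rwa [h.measurableEmbedding.eLpNorm_map_measure] at this

theorem inner_extend (h : IsInduced q ε μ1 μ) {z w : Lp ℂ 2 μ} {b b' : Lp ℂ 2 (wd μ1)}
    (hz : ∀ᵐ t ∂μ, z t = Set.indicator (Set.Ico q 1) b (ε * t))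
    (hw : ∀ᵐ t ∂μ, w t = ((t⁻¹ : ℝ) : ℂ) * Set.indicator (Set.Ico q 1) b' (ε * t)) :
    inner ℂ z w = (ε : ℂ) * inner ℂ b b' := by
  have hA : MeasurableSet ((fun t => ε * t) ⁻¹' Set.Ico q 1) :=
    (measurable_const_mul ε) measurableSet_Ico
  have e1 : inner ℂ z w = ∫ t, Set.indicator ((fun t => ε * t) ⁻¹' Set.Ico q 1)
      (fun t => ((t⁻¹ : ℝ) : ℂ) * inner ℂ (b (ε * t)) (b' (ε * t))) t ∂μ := by
    rw [L2.inner_def]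
    refine integral_congr_ae ?_
    filter_upwards [hz, hw] with t h1 h2
    rw [h1, h2]
    by_cases ht : ε * t ∈ Set.Ico q 1
    · rw [Set.indicator_of_mem ht, Set.indicator_of_mem ht,
        Set.indicator_of_mem (by exact ht)]
      simp only [RCLike.inner_apply]
      ring
    · rw [Set.indicator_of_notMem ht, Set.indicator_of_notMem ht,
        Set.indicator_of_notMem (by exact ht)]
      simp
  have hwd : ∀ g : ℝ → ℂ, ∫ s, g s ∂(wd μ1) = ∫ s, (ENNReal.ofReal s⁻¹).toReal • g s ∂μ1 :=
    integral_withDensity_eq_integral_toReal_smul (by fun_prop)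
      (Filter.Eventually.of_forall fun _ => ENNReal.ofReal_lt_top)
  rw [e1, integral_indicator hA, h.restrict_eq_map, h.measurableEmbedding.integral_map,
    L2.inner_def, hwd, ← integral_const_mul]
  refine integral_congr_ae ?_
  filter_upwards [h.ae_mem] with s hs
  have hs0 : 0 < s := h.pos.trans_le hs.1
  have hε : ε⁻¹ = ε := inv_eq_of_mul_eq_one_left h.sign
  rw [h.sign_mul_sign_mul, ENNReal.toReal_ofReal (inv_nonneg.2 hs0.le), mul_inv, hε]
  rw [Complex.real_smul]
  push_cast
  ring

end IsInduced

end Induced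

section EvenExtension

variable {q : ℝ}

theorem IsEvenExt.eq_zero_of_one_le (hq0 : 0 < q) (hq1 : q < 1) {h he : ℝ → ℂ}
    (H : IsEvenExt q h he) {t : ℝ} (ht : 1 ≤ t) : he t = 0 := by
  refine H.2 t ?_
  rintro ⟨n, s, hs, rfl⟩
  have h1 : q ^ (2 * n) ≤ 1 := pow_le_one₀ hq0.le hq1.le
  have h2 : 0 < q ^ (2 * n) := pow_pos hq0 _
  nlinarith [hs.1, hs.2]

theorem IsEvenExt.eq_add (hq0 : 0 < q) (hq1 : q < 1) {h he : ℝ → ℂ}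
    (H : IsEvenExt q h he) (t : ℝ) :
    he t = Set.indicator (Set.Ico q 1) h t + he (q⁻¹ * (q⁻¹ * t)) := by
  by_cases ht : t ∈ Set.Ico q 1
  · have hqi : 1 < q⁻¹ := (one_lt_inv₀ hq0).2 hq1
    have h1 : 1 ≤ q⁻¹ * t := by
      have := mul_le_mul_of_nonneg_left ht.1 (inv_pos.2 hq0).le
      rwa [inv_mul_cancel₀ hq0.ne'] at this
    have h2 : 1 ≤ q⁻¹ * (q⁻¹ * t) := by nlinarith
    rw [Set.indicator_of_mem ht, H.eq_zero_of_one_le hq0 hq1 h2, add_zero]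
    simpa using H.1 0 t ht
  · rw [Set.indicator_of_notMem ht, zero_add]
    by_cases h1 : ∃ n : ℕ, ∃ s ∈ Set.Ico q 1, t = q ^ (2 * n) * s
    · obtain ⟨n, s, hs, rfl⟩ := h1
      rcases n with _ | n
      · simp at ht
        exact absurd hs.2 (not_lt.2 (ht hs.1))
      · have : q⁻¹ * (q⁻¹ * (q ^ (2 * (n + 1)) * s)) = q ^ (2 * n) * s := by
          rw [show 2 * (n + 1) = 2 * n + 1 + 1 by ring, pow_succ, pow_succ]
          field_simp
        rw [this, H.1 n s hs, H.1 (n + 1) s hs]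
    · rw [H.2 t h1, H.2]
      rintro ⟨n, s, hs, h2⟩
      refine h1 ⟨n + 1, s, hs, ?_⟩
      rw [show 2 * (n + 1) = 2 * n + 1 + 1 by ring, pow_succ, pow_succ]
      rw [inv_mul_eq_iff_eq_mul₀ hq0.ne', inv_mul_eq_iff_eq_mul₀ hq0.ne'] at h2
      rw [h2]
      ring

/-- The even extension is the only solution of its functional equation vanishing on `[1,∞)`. -/
theorem IsEvenExt.eq_of_forall (hq0 : 0 < q) (hq1 : q < 1) {h he v : ℝ → ℂ}
    (H : IsEvenExt q h he) {t : ℝ} (ht : 0 < t)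
    (hv : ∀ n : ℕ, v ((q⁻¹) ^ n * t) =
      Set.indicator (Set.Ico q 1) h ((q⁻¹) ^ n * t) + v (q⁻¹ * (q⁻¹ * ((q⁻¹) ^ n * t))))
    (hv0 : ∀ n : ℕ, 1 ≤ (q⁻¹) ^ n * t → v ((q⁻¹) ^ n * t) = 0) : v t = he t := by
  have hqi : 1 < q⁻¹ := (one_lt_inv₀ hq0).2 hq1
  have key : ∀ k n : ℕ, 1 ≤ (q⁻¹) ^ k * ((q⁻¹) ^ n * t) →
      v ((q⁻¹) ^ n * t) = he ((q⁻¹) ^ n * t) := by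
    intro k
    induction k using Nat.twoStepInduction with
    | zero =>
      intro n hn
      rw [pow_zero, one_mul] at hn
      rw [hv0 n hn, H.eq_zero_of_one_le hq0 hq1 hn]
    | one =>
      intro n hn
      rw [pow_one] at hn
      have e : q⁻¹ * (q⁻¹ * ((q⁻¹) ^ n * t)) = (q⁻¹) ^ (n + 2) * t := by ring
      have e1 : 1 ≤ (q⁻¹) ^ (n + 2) * t := by
        rw [← e]
        nlinarith
      rw [hv n, H.eq_add hq0 hq1, e, hv0 _ e1, H.eq_zero_of_one_le hq0 hq1 e1]
    | more k ih _ =>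
      intro n hn
      have e : q⁻¹ * (q⁻¹ * ((q⁻¹) ^ n * t)) = (q⁻¹) ^ (n + 2) * t := by ring
      rw [hv n, H.eq_add hq0 hq1, e, ih (n + 2)]
      convert hn using 1
      ring
  obtain ⟨k, hk⟩ := pow_unbounded_of_one_lt t⁻¹ hqi
  have := key k 0 (by
    rw [pow_zero, one_mul]
    rw [inv_lt_iff_one_lt_mul₀ ht, mul_comm] at hk
    rw [mul_comm]
    linarith)
  simpa using this

theorem exists_isEvenExt (hq0 : 0 < q) (hq1 : q < 1) (h : ℝ → ℂ) : ∃ he, IsEvenExt q h he := by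
  classical
  refine ⟨fun t => if H : ∃ n : ℕ, ∃ s ∈ Set.Ico q 1, t = q ^ (2 * n) * s then
    h H.choose_spec.choose else 0, fun n t ht => ?_, fun t ht => dif_neg ht⟩
  have H : ∃ m : ℕ, ∃ s ∈ Set.Ico q 1, q ^ (2 * n) * t = q ^ (2 * m) * s := ⟨n, t, ht, rfl⟩
  refine (dif_pos H).trans ?_
  obtain ⟨h1, h2⟩ := H.choose_spec.choose_spec
  have h3 := zpow_eq_of_mem_Ico hq0 hq1 (m := ((2 * n : ℕ) : ℤ))
    (n := ((2 * H.choose : ℕ) : ℤ)) ht h1 (by rw [zpow_natCast, zpow_natCast]; exact h2)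
  have h4 : 2 * n = 2 * H.choose := by exact_mod_cast h3
  exact congrArg h (mul_left_cancel₀ (pow_ne_zero (2 * n) hq0.ne')
    (h2.trans (congrArg (fun m => q ^ m * H.choose_spec.choose) h4.symm))).symm

theorem isOddExt_iff (hq0 : 0 < q) {h ho : ℝ → ℂ} :
    IsOddExt q h ho ↔ IsEvenExt q h (fun t => ho (q * t)) := by
  have e : ∀ (n : ℕ) (s : ℝ), q * (q ^ (2 * n) * s) = q ^ (2 * n + 1) * s := fun n s => by ring
  constructor
  · rintro ⟨h1, h2⟩
    refine ⟨fun n t ht => by simp only [e, h1 n t ht], fun t ht => h2 _ ?_⟩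
    rintro ⟨n, s, hs, h3⟩
    rw [← e] at h3
    exact ht ⟨n, s, hs, mul_left_cancel₀ hq0.ne' h3⟩
  · rintro ⟨h1, h2⟩
    refine ⟨fun n t ht => by rw [← e]; exact h1 n t ht, fun t ht => ?_⟩
    have := h2 (q⁻¹ * t) (by
      rintro ⟨n, s, hs, h3⟩
      rw [inv_mul_eq_iff_eq_mul₀ hq0.ne', e] at h3
      exact ht ⟨n, s, hs, h3⟩)
    simpa only [mul_inv_cancel_left₀ hq0.ne'] using this

theorem isEvenExtNeg_iff {h he : ℝ → ℂ} :
    IsEvenExtNeg q h he ↔ IsEvenExt q h (fun t => he (-1 * t)) := by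
  simp only [IsEvenExtNeg, IsEvenExt, neg_one_mul]
  refine and_congr Iff.rfl ⟨fun H t ht => H _ ?_, fun H t ht => ?_⟩
  · simpa only [neg_inj] using ht
  · have := H (-t) (by simpa only [neg_eq_iff_eq_neg] using ht)
    rwa [neg_neg] at this

theorem isOddExtNeg_iff {h ho : ℝ → ℂ} :
    IsOddExtNeg q h ho ↔ IsOddExt q h (fun t => ho (-1 * t)) := by
  simp only [IsOddExtNeg, IsOddExt, neg_one_mul]
  refine and_congr Iff.rfl ⟨fun H t ht => H _ ?_, fun H t ht => ?_⟩
  · simpa only [neg_inj] using ht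
  · have := H (-t) (by simpa only [neg_eq_iff_eq_neg] using ht)
    rwa [neg_neg] at this

end EvenExtension

section Boundary

variable {I : Type*} {ν : I → Measure ℝ} {q : ℝ} {S S' : HS ν →L[ℂ] HS ν}

/-- `w` is the image of `g` under the maximal operator `i t⁻¹ (g(q⁻¹ t) - g(q t))`. -/
def IsMaxImage (S S' : HS ν →L[ℂ] HS ν) (g w : HS ν) : Prop :=
  IsMul ν (·⁻¹) (Complex.I • (S g - S' g)) w

/-- `z` is supported in the shell `q ≤ |t| < 1`. -/
def IsShell (q : ℝ) (z : HS ν) : Prop :=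
  ∀ i, ∀ᵐ t ∂(ν i), |t| ∉ Set.Ico q 1 → z i t = 0

/-- `f` is, up to an element of the minimal domain, the sum of the even extension of `ze` and the
odd extension of `zo`. -/
def IsDecomp (S : HS ν →L[ℂ] HS ν) (f ze zo : HS ν) : Prop :=
  ∃ p p' ve vo : HS ν, IsMul ν (·⁻¹) p p' ∧ ve - S (S ve) = ze ∧ vo - S (S vo) = zo ∧
    f = p + ve + S vo

theorem IsMaxImage.add {f g w w' : HS ν} (hf : IsMaxImage S S' f w) (hg : IsMaxImage S S' g w') :
    IsMaxImage S S' (f + g) (w + w') := by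
  have e : Complex.I • (S (f + g) - S' (f + g)) =
      Complex.I • (S f - S' f) + Complex.I • (S g - S' g) := by
    rw [map_add, map_add, ← smul_add]; congr 1; abel
  rw [IsMaxImage, e]
  exact IsMul.add hf hg

theorem IsShell.exists_isMul (hq0 : 0 < q) {z : HS ν} (hz : IsShell q z) :
    ∃ y, IsMul ν (·⁻¹) z y := by
  refine (HS.exists_of_ae_le z q⁻¹ (fun i t => ((t⁻¹ : ℝ) : ℂ) * z i t) (fun i => ?_)
    (fun i => ?_)).imp fun y hy i => hy i
  · exact (Complex.measurable_ofReal.comp measurable_inv).aestronglyMeasurable.mul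
      (Lp.aestronglyMeasurable (z i))
  · filter_upwards [hz i] with t ht
    by_cases h : |t| ∈ Set.Ico q 1
    · rw [norm_mul, Complex.norm_real, Real.norm_eq_abs, abs_inv]
      gcongr
      exact h.1
    · rw [ht h]; simp

namespace IsDilation

theorem exists_isMaxImage_of_isMul (h : IsDilation q ν S S') {p p' : HS ν}
    (hp : IsMul ν (·⁻¹) p p') : ∃ w, IsMaxImage S S' p w :=
  ⟨_, ((h.isMul_left hp).sub (h.isMul_right hp)).smul Complex.I⟩

theorem inner_maxImage (h : IsDilation q ν S S') {p p' wp g : HS ν}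
    (hp : IsMul ν (·⁻¹) p p') (hwp : IsMaxImage S S' p wp) :
    inner ℂ g wp = inner ℂ (Complex.I • (S g - S' g)) p' := by
  have hq : (q : ℂ) ≠ 0 := by exact_mod_cast h.pos.ne'
  have h1 : wp = Complex.I • ((q⁻¹ : ℂ) • S p' - (q : ℂ) • S' p') :=
    IsMul.unique hwp (((h.isMul_left hp).sub (h.isMul_right hp)).smul Complex.I)
  rw [h1, inner_smul_right, inner_sub_right, inner_smul_right, inner_smul_right, inner_smul_left,
    inner_sub_left, h.inner_right, h.inner_left, Complex.conj_I]
  field_simp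
  ring

theorem inner_maxImage_comm (h : IsDilation q ν S S') {p p' wp g w : HS ν}
    (hp : IsMul ν (·⁻¹) p p') (hwp : IsMaxImage S S' p wp) (hw : IsMaxImage S S' g w) :
    inner ℂ g wp = inner ℂ w p := by
  rw [h.inner_maxImage hp hwp]
  exact (IsMul.inner_symm hw hp).symm

theorem isMaxImage_even (h : IsDilation q ν S S') {v z y : HS ν} (hv : v - S (S v) = z)
    (hy : IsMul ν (·⁻¹) z y) : IsMaxImage S S' v (-(Complex.I * q) • S' y) := by
  have e : Complex.I • (S v - S' v) = -Complex.I • S' z := by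
    rw [← hv, map_sub, h.right_left, neg_smul, ← smul_neg, neg_sub]
  have := (h.isMul_right hy).smul (-Complex.I)
  rwa [smul_smul, neg_mul, ← e] at this

theorem isMaxImage_odd (h : IsDilation q ν S S') {v z y : HS ν} (hv : v - S (S v) = z)
    (hy : IsMul ν (·⁻¹) z y) : IsMaxImage S S' (S v) (-Complex.I • y) := by
  have e : Complex.I • (S (S v) - S' (S v)) = -Complex.I • z := by
    rw [← hv, h.right_left, neg_smul, ← smul_neg, neg_sub]
  have := hy.smul (-Complex.I)
  rwa [← e] at this

section Support

variable {v z : HS ν}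

theorem left_ae_eq_zero (h : IsDilation q ν S S') {a : ℝ}
    (hv : ∀ i, ∀ᵐ t ∂(ν i), a ≤ |t| → v i t = 0) (i : I) :
    ∀ᵐ t ∂(ν i), q * a ≤ |t| → S v i t = 0 := by
  filter_upwards [h.left_ae v i, h.ae_inv_mul i _ (hv i)] with t h1 h2 h3
  rw [h1, h2]
  rwa [abs_mul, abs_inv, abs_of_pos h.pos, inv_mul_eq_div, le_div_iff₀ h.pos, mul_comm]

theorem ae_eq_zero_of_isShell (h : IsDilation q ν S S') (hv : v - S (S v) = z)
    (hz : IsShell q z) : ∀ i, ∀ᵐ t ∂(ν i), 1 ≤ |t| → v i t = 0 := by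
  refine h.ae_eq_zero hv fun i => ?_
  filter_upwards [hz i] with t h1 h2
  exact h1 fun h3 => absurd h3.2 (not_lt.2 h2)

theorem inner_shell (h : IsDilation q ν S S') (hv : v - S (S v) = z) (hz : IsShell q z)
    {y : HS ν} (hy : IsShell q y) : inner ℂ v y = inner ℂ z y := by
  have h1 := h.left_ae_eq_zero (h.left_ae_eq_zero (h.ae_eq_zero_of_isShell hv hz))
  have h2 : inner ℂ (S (S v)) y = 0 := by
    refine HS.inner_eq_zero_of_ae fun i => ?_
    filter_upwards [h1 i, hy i] with t h3 h4
    by_cases ht : |t| ∈ Set.Ico q 1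
    · exact Or.inl (h3 (by nlinarith [h.pos, h.lt_one, ht.1]))
    · exact Or.inr (h4 ht)
  rw [← hv, inner_sub_left, h2, sub_zero]

theorem inner_left_shell (h : IsDilation q ν S S') (hv : v - S (S v) = z) (hz : IsShell q z)
    {y : HS ν} (hy : IsShell q y) : inner ℂ (S v) y = 0 := by
  refine HS.inner_eq_zero_of_ae fun i => ?_
  filter_upwards [h.left_ae_eq_zero (h.ae_eq_zero_of_isShell hv hz) i, hy i] with t h3 h4
  by_cases ht : |t| ∈ Set.Ico q 1
  · exact Or.inl (h3 (by linarith [ht.1]))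
  · exact Or.inr (h4 ht)

theorem right_shell_ae_eq_zero (h : IsDilation q ν S S') {y : HS ν} (hy : IsShell q y) (i : I) :
    ∀ᵐ t ∂(ν i), |t| < 1 → S' y i t = 0 := by
  filter_upwards [h.right_ae y i, h.ae_mul i _ (hy i)] with t h1 h2 h3
  rw [h1, h2]
  rw [abs_mul, abs_of_pos h.pos]
  exact fun h4 => by nlinarith [h4.1, h.pos]

theorem inner_right_shell (h : IsDilation q ν S S') (hv : v - S (S v) = z) (hz : IsShell q z)
    {y : HS ν} (hy : IsShell q y) : inner ℂ v (S' y) = 0 := by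
  refine HS.inner_eq_zero_of_ae fun i => ?_
  filter_upwards [h.ae_eq_zero_of_isShell hv hz i, h.right_shell_ae_eq_zero hy i] with t h3 h4
  exact (le_or_gt 1 |t|).imp h3 h4

theorem inner_left_right_shell (h : IsDilation q ν S S') (hv : v - S (S v) = z)
    (hz : IsShell q z) {y : HS ν} (hy : IsShell q y) : inner ℂ (S v) (S' y) = 0 := by
  refine HS.inner_eq_zero_of_ae fun i => ?_
  filter_upwards [h.left_ae_eq_zero (h.ae_eq_zero_of_isShell hv hz) i,
    h.right_shell_ae_eq_zero hy i] with t h3 h4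
  exact (le_or_gt 1 |t|).imp (fun h5 => h3 (by linarith [h.lt_one])) h4

end Support

theorem isShell_of_isMul {z y : HS ν} (hz : IsShell q z) (hy : IsMul ν (·⁻¹) z y) :
    IsShell q y := by
  intro i
  filter_upwards [hz i, hy i] with t h1 h2 h3
  rw [h2, h1 h3, mul_zero]

theorem exists_isMaxImage (h : IsDilation q ν S S') {f ze zo : HS ν} (hf : IsDecomp S f ze zo)
    (hze : IsShell q ze) (hzo : IsShell q zo) : ∃ w, IsMaxImage S S' f w := by
  obtain ⟨p, p', ve, vo, hp, hve, hvo, rfl⟩ := hf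
  obtain ⟨ye, hye⟩ := hze.exists_isMul h.pos
  obtain ⟨yo, hyo⟩ := hzo.exists_isMul h.pos
  obtain ⟨wp, hwp⟩ := h.exists_isMaxImage_of_isMul hp
  exact ⟨_, (hwp.add (h.isMaxImage_even hve hye)).add (h.isMaxImage_odd hvo hyo)⟩

/-- Green's formula for the maximal operator. -/
theorem inner_maxImage_sub (h : IsDilation q ν S S') {f g ze zo ze' zo' ye' yo' w w' : HS ν}
    (hf : IsDecomp S f ze zo) (hze : IsShell q ze) (hzo : IsShell q zo)
    (hg : IsDecomp S g ze' zo') (hze' : IsShell q ze') (hzo' : IsShell q zo')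
    (hye' : IsMul ν (·⁻¹) ze' ye') (hyo' : IsMul ν (·⁻¹) zo' yo')
    (hw : IsMaxImage S S' f w) (hw' : IsMaxImage S S' g w') :
    inner ℂ w g - inner ℂ f w' = Complex.I * (inner ℂ zo ye' + inner ℂ ze yo') := by
  obtain ⟨p, p₁, ve, vo, hp, hve, hvo, rfl⟩ := hf
  obtain ⟨r, r₁, ve', vo', hr, hve', hvo', rfl⟩ := hg
  obtain ⟨ye, hye⟩ := hze.exists_isMul h.pos
  obtain ⟨yo, hyo⟩ := hzo.exists_isMul h.pos
  obtain ⟨wp, hwp⟩ := h.exists_isMaxImage_of_isMul hp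
  obtain ⟨wr, hwr⟩ := h.exists_isMaxImage_of_isMul hr
  have a1 := h.isMaxImage_even hve hye
  have a2 := h.isMaxImage_odd hvo hyo
  have b1 := h.isMaxImage_even hve' hye'
  have b2 := h.isMaxImage_odd hvo' hyo'
  have s1 := isShell_of_isMul hze hye
  have s2 := isShell_of_isMul hzo hyo
  have s1' := isShell_of_isMul hze' hye'
  have s2' := isShell_of_isMul hzo' hyo'
  have ew : w = wp + -(Complex.I * q) • S' ye + -Complex.I • yo :=
    IsMul.unique hw ((hwp.add a1).add a2)
  have ew' : w' = wr + -(Complex.I * q) • S' ye' + -Complex.I • yo' :=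
    IsMul.unique hw' ((hwr.add b1).add b2)
  have c1 : inner ℂ wp (r + ve' + S vo') = inner ℂ p w' := by
    rw [← inner_conj_symm, h.inner_maxImage_comm hp hwp hw', inner_conj_symm]
  have c2 := h.inner_maxImage_comm hr hwr (a1.add a2)
  have d1 : inner ℂ (S' ye) ve' = 0 := by
    rw [← inner_conj_symm, h.inner_right_shell hve' hze' s1, map_zero]
  have d2 : inner ℂ (S' ye) (S vo') = 0 := by
    rw [← inner_conj_symm, h.inner_left_right_shell hvo' hzo' s1, map_zero]
  have d3 : inner ℂ yo ve' = inner ℂ zo ye' := by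
    rw [← inner_conj_symm, h.inner_shell hve' hze' s2, inner_conj_symm, hyo.inner_symm hye']
  have d4 : inner ℂ yo (S vo') = 0 := by
    rw [← inner_conj_symm, h.inner_left_shell hvo' hzo' s2, map_zero]
  have e1 := h.inner_right_shell hve hze s1'
  have e2 := h.inner_left_right_shell hvo hzo s1'
  have e3 := h.inner_shell hve hze s2'
  have e4 := h.inner_left_shell hvo hzo s2'
  have k1 : inner ℂ w (r + ve' + S vo') = inner ℂ p w' + inner ℂ (ve + S vo) wr +
      Complex.I * inner ℂ zo ye' := by
    rw [ew, add_assoc wp, inner_add_left, c1, add_assoc r, inner_add_right _ r, ← c2]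
    simp only [inner_add_left, inner_add_right, inner_smul_left, d1, d2, d3, d4, map_neg,
      Complex.conj_I]
    ring
  have k2 : inner ℂ (p + ve + S vo) w' = inner ℂ p w' + inner ℂ (ve + S vo) wr -
      Complex.I * inner ℂ ze yo' := by
    rw [add_assoc p, inner_add_left p]
    nth_rw 2 [ew']
    simp only [inner_add_left, inner_add_right, inner_smul_right, e1, e2, e3, e4]
    ring
  rw [k1, k2]
  ring

theorem isDecomp_left (h : IsDilation q ν S S') {f ze zo : HS ν} (hf : IsDecomp S f ze zo)
    (hzo : IsShell q zo) : IsDecomp S (S f) zo ze := by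
  obtain ⟨p, p', ve, vo, hp, hve, hvo, rfl⟩ := hf
  obtain ⟨yo, hyo⟩ := hzo.exists_isMul h.pos
  refine ⟨_, _, vo, ve, (h.isMul_left hp).sub hyo, hvo, hve, ?_⟩
  rw [map_add, map_add, ← hvo]
  abel

theorem isDecomp_right (h : IsDilation q ν S S') {f ze zo : HS ν} (hf : IsDecomp S f ze zo)
    (hze : IsShell q ze) : IsDecomp S (S' f) zo ze := by
  obtain ⟨p, p', ve, vo, hp, hve, hvo, rfl⟩ := hf
  obtain ⟨ye, hye⟩ := hze.exists_isMul h.pos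
  refine ⟨_, _, vo, ve, (h.isMul_right hp).add (h.isMul_right hye), hvo, hve, ?_⟩
  rw [map_add, map_add, ← hve, map_sub, h.right_left, h.right_left]
  abel

theorem isMaxImage_right (h : IsDilation q ν S S') {f w : HS ν} (hf : IsMaxImage S S' f w) :
    IsMaxImage S S' (S' f) ((q : ℂ) • S' w) := by
  have := h.isMul_right hf
  rwa [map_smul, map_sub, h.right_left, ← h.left_right f, h.right_left] at this

end IsDilation

end Boundary

section Trace

variable {Ip Im : Type*} {μ1p : Ip → Measure ℝ} {μ1m : Im → Measure ℝ}
  {ν : Ip ⊕ Im → Measure ℝ} {q : ℝ}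

/-- `z` is the element supported in the shell `q ≤ |t| < 1` with the given boundary values on the
positive and on the negative half-axis. -/
def IsEmb (q : ℝ) (b : HS (fun j => wd (μ1p j))) (c : HS (fun j => wd (μ1m j))) (z : HS ν) : Prop :=
  (∀ j, ∀ᵐ t ∂(ν (Sum.inl j)), z (Sum.inl j) t = Set.indicator (Set.Ico q 1) (b j) (1 * t)) ∧
  (∀ j, ∀ᵐ t ∂(ν (Sum.inr j)), z (Sum.inr j) t = Set.indicator (Set.Ico q 1) (c j) (-1 * t))

theorem IsEmb.isShell (hp : ∀ j, IsInduced q 1 (μ1p j) (ν (Sum.inl j)))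
    (hm : ∀ j, IsInduced q (-1) (μ1m j) (ν (Sum.inr j))) {b : HS (fun j => wd (μ1p j))}
    {c : HS (fun j => wd (μ1m j))} {z : HS ν} (hz : IsEmb q b c z) :
    IsShell q z := by
  rintro (j | j)
  · filter_upwards [hz.1 j, (hp j).ae_abs] with t h1 h2 h3
    rw [h2] at h3
    exact h1.trans (Set.indicator_of_notMem h3 _)
  · filter_upwards [hz.2 j, (hm j).ae_abs] with t h1 h2 h3
    rw [h2] at h3
    exact h1.trans (Set.indicator_of_notMem h3 _)

theorem exists_isEmb (hp : ∀ j, IsInduced q 1 (μ1p j) (ν (Sum.inl j)))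
    (hm : ∀ j, IsInduced q (-1) (μ1m j) (ν (Sum.inr j))) (b : HS (fun j => wd (μ1p j)))
    (c : HS (fun j => wd (μ1m j))) : ∃ z : HS ν, IsEmb q b c z := by
  obtain ⟨z1, hz1⟩ := HS.exists_of_memLp (ν := ν) b (Sum.elim some fun _ => none)
    (by rintro (i | i) (i' | i') j h h' <;> simp_all) 1
    (Sum.elim (fun j t => Set.indicator (Set.Ico q 1) (b j) (1 * t)) fun _ _ => 0)
    (by
      rintro (j | j)
      · exact (hp j).memLp_extend (b j)
      · exact MemLp.zero)
    (by
      rintro (j | j) h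
      · simp at h
      · exact eLpNorm_zero)
    (by
      rintro (j | j) i h
      · simp only [Sum.elim_inl, Option.some.injEq] at h
        subst h
        exact (hp j).eLpNorm_extend_le (b j)
      · simp at h)
  obtain ⟨z2, hz2⟩ := HS.exists_of_memLp (ν := ν) c (Sum.elim (fun _ => none) some)
    (by rintro (i | i) (i' | i') j h h' <;> simp_all) 1
    (Sum.elim (fun _ _ => 0) fun j t => Set.indicator (Set.Ico q 1) (c j) (-1 * t))
    (by
      rintro (j | j)
      · exact MemLp.zero
      · exact (hm j).memLp_extend (c j))
    (by
      rintro (j | j) h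
      · exact eLpNorm_zero
      · simp at h)
    (by
      rintro (j | j) i h
      · simp at h
      · simp only [Sum.elim_inr, Option.some.injEq] at h
        subst h
        exact (hm j).eLpNorm_extend_le (c j))
  refine ⟨z1 + z2, fun j => ?_, fun j => ?_⟩
  · have h1 := hz1 (Sum.inl j)
    have h2 := hz2 (Sum.inl j)
    have h3 := HS.add_ae z1 z2 (Sum.inl j)
    filter_upwards [h1, h2, h3] with t h1 h2 h3
    exact h3.trans ((congrArg₂ (· + ·) h1 h2).trans (add_zero _))
  · have h1 := hz1 (Sum.inr j)
    have h2 := hz2 (Sum.inr j)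
    have h3 := HS.add_ae z1 z2 (Sum.inr j)
    filter_upwards [h1, h2, h3] with t h1 h2 h3
    exact h3.trans ((congrArg₂ (· + ·) h1 h2).trans (zero_add _))

theorem exists_isEmb_of_isShell (hp : ∀ j, IsInduced q 1 (μ1p j) (ν (Sum.inl j)))
    (hm : ∀ j, IsInduced q (-1) (μ1m j) (ν (Sum.inr j))) {z : HS ν} (hz : IsShell q z) :
    ∃ b : HS (fun j => wd (μ1p j)), ∃ c : HS (fun j => wd (μ1m j)), IsEmb q b c z := by
  obtain ⟨b, hb⟩ := HS.exists_of_memLp (ν := fun j => wd (μ1p j)) z (fun j => some (Sum.inl j))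
    (by intro i i' j h h'; simpa using h.trans h'.symm) ((q⁻¹) ^ ((1 : ℝ) / 2))
    (fun j s => z (Sum.inl j) (1 * s)) (fun j => (hp j).memLp_trace (z (Sum.inl j)))
    (by simp)
    (by
      intro i j h
      simp only [Option.some.injEq] at h
      subst h
      exact (hp i).eLpNorm_trace_le (z (Sum.inl i)))
  obtain ⟨c, hc⟩ := HS.exists_of_memLp (ν := fun j => wd (μ1m j)) z (fun j => some (Sum.inr j))
    (by intro i i' j h h'; simpa using h.trans h'.symm) ((q⁻¹) ^ ((1 : ℝ) / 2))
    (fun j s => z (Sum.inr j) (-1 * s)) (fun j => (hm j).memLp_trace (z (Sum.inr j)))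
    (by simp)
    (by
      intro i j h
      simp only [Option.some.injEq] at h
      subst h
      exact (hm i).eLpNorm_trace_le (z (Sum.inr i)))
  refine ⟨b, c, fun j => ?_, fun j => ?_⟩
  · have h0 := hz (Sum.inl j)
    filter_upwards [h0, (hp j).ae_abs, (hp j).ae_of_ae_wd (hb j)] with t h1 h2 h3
    by_cases ht : 1 * t ∈ Set.Ico q 1
    · rw [Set.indicator_of_mem ht, h3 ht, (hp j).sign_mul_sign_mul]
    · rw [Set.indicator_of_notMem ht]
      exact h1 (by rwa [h2])
  · have h0 := hz (Sum.inr j)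
    filter_upwards [h0, (hm j).ae_abs, (hm j).ae_of_ae_wd (hc j)] with t h1 h2 h3
    by_cases ht : -1 * t ∈ Set.Ico q 1
    · rw [Set.indicator_of_mem ht, h3 ht, (hm j).sign_mul_sign_mul]
    · rw [Set.indicator_of_notMem ht]
      exact h1 (by rwa [h2])

theorem isEmb_zero (hp : ∀ j, IsInduced q 1 (μ1p j) (ν (Sum.inl j)))
    (hm : ∀ j, IsInduced q (-1) (μ1m j) (ν (Sum.inr j))) :
    IsEmb q (0 : HS (fun j => wd (μ1p j))) (0 : HS (fun j => wd (μ1m j)))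
      (0 : HS ν) := by
  refine ⟨fun j => ?_, fun j => ?_⟩
  · have h0 := HS.zero_ae (ν := ν) (Sum.inl j)
    filter_upwards [h0, (hp j).ae_of_ae_wd (HS.zero_ae (ν := fun j => wd (μ1p j)) j)] with t h1 h2
    rw [h1]
    by_cases ht : 1 * t ∈ Set.Ico q 1
    · rw [Set.indicator_of_mem ht, h2 ht]
    · rw [Set.indicator_of_notMem ht]
  · have h0 := HS.zero_ae (ν := ν) (Sum.inr j)
    filter_upwards [h0, (hm j).ae_of_ae_wd (HS.zero_ae (ν := fun j => wd (μ1m j)) j)] with t h1 h2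
    rw [h1]
    by_cases ht : -1 * t ∈ Set.Ico q 1
    · rw [Set.indicator_of_mem ht, h2 ht]
    · rw [Set.indicator_of_notMem ht]

theorem IsEmb.inner_eq (hp : ∀ j, IsInduced q 1 (μ1p j) (ν (Sum.inl j)))
    (hm : ∀ j, IsInduced q (-1) (μ1m j) (ν (Sum.inr j))) {b b' : HS (fun j => wd (μ1p j))}
    {c c' : HS (fun j => wd (μ1m j))} {z z' y' : HS ν} (hz : IsEmb q b c z)
    (hz' : IsEmb q b' c' z') (hy' : IsMul ν (·⁻¹) z' y') :
    inner ℂ z y' = inner ℂ b b' - inner ℂ c c' := by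
  have e1 : ∀ j, inner ℂ (z (Sum.inl j)) (y' (Sum.inl j)) = inner ℂ (b j) (b' j) := fun j => by
    have h0 := hy' (Sum.inl j)
    have := (hp j).inner_extend (z := z (Sum.inl j)) (w := y' (Sum.inl j)) (hz.1 j) (b' := b' j) (by
      filter_upwards [h0, hz'.1 j] with t h1 h2
      rw [h1, h2])
    simpa using this
  have e2 : ∀ j, inner ℂ (z (Sum.inr j)) (y' (Sum.inr j)) = -inner ℂ (c j) (c' j) := fun j => by
    have h0 := hy' (Sum.inr j)
    have := (hm j).inner_extend (z := z (Sum.inr j)) (w := y' (Sum.inr j)) (hz.2 j) (b' := c' j) (by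
      filter_upwards [h0, hz'.2 j] with t h1 h2
      rw [h1, h2])
    simpa using this
  have s1 := lp.hasSum_inner (𝕜 := ℂ) b b'
  have s2 := (lp.hasSum_inner (𝕜 := ℂ) c c').neg
  simp only [← e1, ← e2] at s1 s2
  rw [sub_eq_add_neg]
  exact (lp.hasSum_inner (𝕜 := ℂ) z y').unique (HasSum.sum s1 s2)

end Trace

section Extension

variable {I : Type*} {ν : I → Measure ℝ} {q ε : ℝ} {S S' : HS ν →L[ℂ] HS ν} {μ1 : Measure ℝ}
  {i : I}

theorem IsDilation.ae_eq_evenExt (h : IsDilation q ν S S') (H : IsInduced q ε μ1 (ν i))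
    {v z : HS ν} (hv : v - S (S v) = z) (hz : IsShell q z) {b he : ℝ → ℂ}
    (hb : ∀ᵐ t ∂(ν i), z i t = Set.indicator (Set.Ico q 1) b (ε * t)) (hhe : IsEvenExt q b he) :
    ∀ᵐ t ∂(ν i), v i t = he (ε * t) := by
  have key : ∀ᵐ t ∂(ν i), |t| = ε * t ∧ (1 ≤ |t| → v i t = 0) ∧
      v i t = Set.indicator (Set.Ico q 1) b (ε * t) + v i (q⁻¹ * (q⁻¹ * t)) := by
    filter_upwards [H.ae_abs, h.ae_eq_zero_of_isShell hv hz i, hb, h.left_left_ae v i,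
      HS.sub_ae v (S (S v)) i] with t h1 h2 h3 h4 h5
    refine ⟨h1, h2, ?_⟩
    rw [hv, h3, h4] at h5
    rw [h5, sub_add_cancel]
  have key' : ∀ᵐ t ∂(ν i), ∀ n : ℕ, |(q⁻¹) ^ n * t| = ε * ((q⁻¹) ^ n * t) ∧
      (1 ≤ |(q⁻¹) ^ n * t| → v i ((q⁻¹) ^ n * t) = 0) ∧ v i ((q⁻¹) ^ n * t) =
        Set.indicator (Set.Ico q 1) b (ε * ((q⁻¹) ^ n * t)) +
          v i (q⁻¹ * (q⁻¹ * ((q⁻¹) ^ n * t))) := by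
    rw [ae_all_iff]
    intro n
    induction n with
    | zero => simpa only [pow_zero, one_mul] using key
    | succ n ih =>
      filter_upwards [H.ae_inv_mul ih] with t ht
      simpa only [pow_succ, mul_assoc] using ht
  filter_upwards [key', H.ae_pos] with t h1 h2
  have e : ∀ n : ℕ, ε * ((q⁻¹) ^ n * (ε * t)) = (q⁻¹) ^ n * t := fun n => by
    rw [mul_left_comm, H.sign_mul_sign_mul]
  have e' : ∀ n : ℕ, (q⁻¹) ^ n * (ε * t) = ε * ((q⁻¹) ^ n * t) := fun n => mul_left_comm _ _ _
  have := hhe.eq_of_forall H.pos H.lt_one (v := fun x => v i (ε * x)) h2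
    (fun n => ?_) (fun n hn => ?_)
  · rwa [H.sign_mul_sign_mul] at this
  · have h3 := (h1 n).2.2
    simp only [mul_left_comm ε q⁻¹, e]
    rwa [e']
  · simp only [e]
    refine (h1 n).2.1 ?_
    rwa [(h1 n).1, ← e']

theorem IsDilation.ae_eq_oddExt (h : IsDilation q ν S S') (H : IsInduced q ε μ1 (ν i))
    {v z : HS ν} (hv : v - S (S v) = z) (hz : IsShell q z) {b ho : ℝ → ℂ}
    (hb : ∀ᵐ t ∂(ν i), z i t = Set.indicator (Set.Ico q 1) b (ε * t)) (hho : IsOddExt q b ho) :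
    ∀ᵐ t ∂(ν i), S v i t = ho (ε * t) := by
  have h1 := h.ae_eq_evenExt H hv hz hb ((isOddExt_iff H.pos).1 hho)
  filter_upwards [h.left_ae v i, H.ae_inv_mul h1] with t h2 h3
  rw [h2, h3, mul_left_comm ε, mul_inv_cancel_left₀ H.pos.ne']

theorem exists_isOddExt (hq0 : 0 < q) (hq1 : q < 1) (h : ℝ → ℂ) : ∃ ho, IsOddExt q h ho := by
  obtain ⟨he, H⟩ := exists_isEvenExt hq0 hq1 h
  refine ⟨fun t => he (q⁻¹ * t), (isOddExt_iff hq0).2 ?_⟩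
  simpa only [inv_mul_cancel_left₀ hq0.ne'] using H

theorem IsDilation.exists_ext_iff (h : IsDilation q ν S S') (H : IsInduced q ε μ1 (ν i))
    {f p ve vo ze zo : HS ν} (hve : ve - S (S ve) = ze) (hvo : vo - S (S vo) = zo)
    (hze : IsShell q ze) (hzo : IsShell q zo) {b b' : ℝ → ℂ}
    (hb : ∀ᵐ t ∂(ν i), ze i t = Set.indicator (Set.Ico q 1) b (ε * t))
    (hb' : ∀ᵐ t ∂(ν i), zo i t = Set.indicator (Set.Ico q 1) b' (ε * t)) :
    (∃ he ho : ℝ → ℂ, IsEvenExt q b (fun t => he (ε * t)) ∧ IsOddExt q b' (fun t => ho (ε * t)) ∧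
      ∀ᵐ t ∂(ν i), f i t = p i t + he t + ho t) ↔
      ∀ᵐ t ∂(ν i), f i t = (p + ve + S vo) i t := by
  constructor
  · rintro ⟨he, ho, h1, h2, h3⟩
    filter_upwards [h3, HS.add_ae (p + ve) (S vo) i, HS.add_ae p ve i,
      h.ae_eq_evenExt H hve hze hb h1, h.ae_eq_oddExt H hvo hzo hb' h2] with t k1 k2 k3 k4 k5
    rw [k1, k2, k3, k4, k5, H.sign_mul_sign_mul]
  · intro h3
    obtain ⟨he, h1⟩ := exists_isEvenExt H.pos H.lt_one b
    obtain ⟨ho, h2⟩ := exists_isOddExt H.pos H.lt_one b'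
    refine ⟨fun t => he (ε * t), fun t => ho (ε * t), ?_, ?_, ?_⟩
    · simpa only [H.sign_mul_sign_mul] using h1
    · simpa only [H.sign_mul_sign_mul] using h2
    · filter_upwards [h3, HS.add_ae (p + ve) (S vo) i, HS.add_ae p ve i,
        h.ae_eq_evenExt H hve hze hb h1, h.ae_eq_oddExt H hvo hzo hb' h2] with t k1 k2 k3 k4 k5
      rw [k1, k2, k3, k4, k5]

end Extension

section MinimalOperator

variable {I : Type*} {ν : I → Measure ℝ} {q : ℝ} {S S' : HS ν →L[ℂ] HS ν}
  {X : HS ν →ₗ.[ℂ] HS ν}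

theorem IsXop.mem_domain_iff (hX : IsXop q ν X) {f : HS ν} :
    f ∈ X.domain ↔ ∃ g, IsMul ν (·⁻¹) f g := by
  simp only [hX.1, IsMul, Complex.ofReal_inv]

theorem IsXop.isMaxImage (hX : IsXop q ν X) (h : IsDilation q ν S S') (f : X.domain) :
    IsMaxImage S S' f (X f) := by
  intro i
  filter_upwards [hX.2 f i, HS.smul_ae Complex.I (S (f : HS ν) - S' (f : HS ν)) i,
    HS.sub_ae (S (f : HS ν)) (S' (f : HS ν)) i, h.left_ae f i, h.right_ae f i]
    with t h1 h2 h3 h4 h5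
  rw [h1, h2, h3, h4, h5, Complex.ofReal_inv]
  ring

theorem IsXop.dense_domain (hX : IsXop q ν X) (h : IsDilation q ν S S') :
    Dense (X.domain : Set (HS ν)) := by
  rw [Submodule.dense_iff_topologicalClosure_eq_top, Submodule.topologicalClosure_eq_top_iff,
    Submodule.eq_bot_iff]
  intro w hw
  have : IsMul ν (·⁻¹) 0 w := IsMul.of_inner h.ae_ne_zero fun f f' hf => by
    rw [inner_zero_left, ← inner_conj_symm,
      (Submodule.mem_orthogonal _ _).1 hw f (hX.mem_domain_iff.2 ⟨f', hf⟩), map_zero]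
  refine IsMul.unique this fun i => ?_
  filter_upwards [HS.zero_ae (ν := ν) i] with t h0
  rw [h0, mul_zero]

theorem IsXop.isMaxImage_of_inner (hX : IsXop q ν X) (h : IsDilation q ν S S') {g w : HS ν}
    (H : ∀ f : X.domain, inner ℂ w (f : HS ν) = inner ℂ g (X f)) : IsMaxImage S S' g w := by
  refine IsMul.of_inner h.ae_ne_zero fun f f' hf => ?_
  have hf' : f ∈ X.domain := hX.mem_domain_iff.2 ⟨f', hf⟩
  rw [← h.inner_maxImage hf (hX.isMaxImage h ⟨f, hf'⟩)]
  exact H ⟨f, hf'⟩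

theorem IsXop.isMaxImage_adjoint (hX : IsXop q ν X) (h : IsDilation q ν S S')
    (g : X.adjoint.domain) : IsMaxImage S S' g (X.adjoint g) :=
  hX.isMaxImage_of_inner h (LinearPMap.adjoint_isFormalAdjoint (hX.dense_domain h) g)

theorem IsXop.mem_adjoint_domain (hX : IsXop q ν X) (h : IsDilation q ν S S') {g w : HS ν}
    (hg : IsMaxImage S S' g w) : g ∈ X.adjoint.domain := by
  refine LinearPMap.mem_adjoint_domain_of_exists g ⟨w, fun f => ?_⟩
  obtain ⟨f', hf⟩ := hX.mem_domain_iff.1 f.2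
  exact (h.inner_maxImage_comm hf (hX.isMaxImage h f) hg).symm

end MinimalOperator

section UnitaryDilation

variable {I : Type*} {ν : I → Measure ℝ} {q : ℝ}

theorem IsUop.isDilation (hq0 : 0 < q) (hq1 : q < 1) (h0 : ∀ i, ∀ᵐ t ∂(ν i), t ≠ 0)
    (h1 : ∀ i, ∀ p : ℝ → Prop, (∀ᵐ t ∂(ν i), p t) → ∀ᵐ t ∂(ν i), p (q * t))
    (h2 : ∀ i, ∀ p : ℝ → Prop, (∀ᵐ t ∂(ν i), p t) → ∀ᵐ t ∂(ν i), p (q⁻¹ * t))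
    {U : HS ν ≃ₗᵢ[ℂ] HS ν} (hU : IsUop q ν U) :
    IsDilation q ν
      (((q ^ ((1 : ℝ) / 2) : ℝ) : ℂ) • (U.symm.toContinuousLinearEquiv : HS ν →L[ℂ] HS ν))
      (((q ^ ((1 : ℝ) / 2) : ℝ) : ℂ)⁻¹ • (U.toContinuousLinearEquiv : HS ν →L[ℂ] HS ν)) := by
  have hc0 : ((q ^ ((1 : ℝ) / 2) : ℝ) : ℂ) ≠ 0 := by
    exact_mod_cast (Real.rpow_pos_of_pos hq0 _).ne'
  have hcc : ((q ^ ((1 : ℝ) / 2) : ℝ) : ℂ) * ((q ^ ((1 : ℝ) / 2) : ℝ) : ℂ) = q := by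
    rw [← Complex.ofReal_mul, ← Real.rpow_add hq0]
    norm_num
  unfold IsUop at hU
  set c : ℂ := ((q ^ ((1 : ℝ) / 2) : ℝ) : ℂ) with hc
  refine ⟨hq0, hq1, h0, h1, h2, fun f i => ?_, fun f i => ?_, fun f g => ?_⟩
  · filter_upwards [HS.smul_ae c (U.symm f) i, h2 i _ (hU (U.symm f) i)] with t k1 k2
    rw [U.apply_symm_apply, mul_inv_cancel_left₀ hq0.ne'] at k2
    exact k1.trans k2.symm
  · filter_upwards [HS.smul_ae c⁻¹ (U f) i, hU f i] with t k1 k2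
    rw [k2, inv_mul_cancel_left₀ hc0] at k1
    exact k1
  · change inner ℂ (c • U.symm f) g = (q : ℂ) * inner ℂ f (c⁻¹ • U g)
    rw [inner_smul_left, inner_smul_right, hc, Complex.conj_ofReal, ← hc, ← hcc, mul_assoc,
      mul_inv_cancel_left₀ hc0, ← U.inner_map_map, U.apply_symm_apply]

end UnitaryDilation

section BoundaryData

variable {Ip Im : Type*} {μ1p : Ip → Measure ℝ} {μ1m : Im → Measure ℝ}
  {ν : Ip ⊕ Im → Measure ℝ} {q : ℝ} {S S' : HS ν →L[ℂ] HS ν}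

/-- `be, bo` (`ce, co`) are the even and odd boundary values of `f` on the positive (negative)
half-axis. -/
def HasBdry (q : ℝ) (S : HS ν →L[ℂ] HS ν) (be bo : HS (fun j => wd (μ1p j)))
    (ce co : HS (fun j => wd (μ1m j))) (f : HS ν) : Prop :=
  ∃ ze zo, IsEmb q be ce ze ∧ IsEmb q bo co zo ∧ IsDecomp S f ze zo

variable (hp : ∀ j, IsInduced q 1 (μ1p j) (ν (Sum.inl j)))
    (hm : ∀ j, IsInduced q (-1) (μ1m j) (ν (Sum.inr j))) (h : IsDilation q ν S S')

include hp hm h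

theorem HasBdry.exists_isMaxImage {be bo : HS (fun j => wd (μ1p j))}
    {ce co : HS (fun j => wd (μ1m j))} {f : HS ν} (hf : HasBdry q S be bo ce co f) :
    ∃ w, IsMaxImage S S' f w := by
  obtain ⟨ze, zo, h1, h2, h3⟩ := hf
  exact h.exists_isMaxImage h3 (h1.isShell hp hm) (h2.isShell hp hm)

theorem exists_hasBdry (be bo : HS (fun j => wd (μ1p j))) (ce co : HS (fun j => wd (μ1m j))) :
    ∃ f : HS ν, HasBdry q S be bo ce co f := by
  obtain ⟨ze, hze⟩ := exists_isEmb hp hm be ce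
  obtain ⟨zo, hzo⟩ := exists_isEmb hp hm bo co
  obtain ⟨ve, hve⟩ := h.exists_sub_left_left ze
  obtain ⟨vo, hvo⟩ := h.exists_sub_left_left zo
  refine ⟨0 + ve + S vo, ze, zo, hze, hzo, 0, 0, ve, vo, fun i => ?_, hve, hvo, rfl⟩
  filter_upwards [HS.zero_ae (ν := ν) i] with t h0
  rw [h0, mul_zero]

theorem IsMaxImage.exists_hasBdry {g w : HS ν} (hg : IsMaxImage S S' g w) :
    ∃ be bo : HS (fun j => wd (μ1p j)), ∃ ce co : HS (fun j => wd (μ1m j)),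
      HasBdry q S be bo ce co g := by
  have hg' : IsMul ν (·⁻¹) (S g - S' g) (-Complex.I • w) := by
    have := IsMul.smul hg (-Complex.I)
    rwa [smul_smul, neg_mul, Complex.I_mul_I, neg_neg, one_smul] at this
  obtain ⟨p, p', ve, vo, hpp, hve, hvo, e⟩ := h.exists_decomposition hg'
  obtain ⟨be, ce, hb⟩ := exists_isEmb_of_isShell hp hm hve
  obtain ⟨bo, co, hb'⟩ := exists_isEmb_of_isShell hp hm hvo
  exact ⟨be, bo, ce, co, _, _, hb, hb', p, p', ve, vo, hpp, rfl, rfl, e⟩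

omit h in
theorem IsMul.hasBdry_zero {p p' : HS ν} (hpp : IsMul ν (·⁻¹) p p') :
    HasBdry q S (0 : HS (fun j => wd (μ1p j))) 0 (0 : HS (fun j => wd (μ1m j))) 0 p :=
  ⟨0, 0, isEmb_zero hp hm, isEmb_zero hp hm, p, p', 0, 0, hpp, by simp, by simp, by simp⟩

theorem HasBdry.left {be bo : HS (fun j => wd (μ1p j))} {ce co : HS (fun j => wd (μ1m j))}
    {f : HS ν} (hf : HasBdry q S be bo ce co f) : HasBdry q S bo be co ce (S f) := by
  obtain ⟨ze, zo, h1, h2, h3⟩ := hf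
  exact ⟨zo, ze, h2, h1, h.isDecomp_left h3 (h2.isShell hp hm)⟩

theorem HasBdry.right {be bo : HS (fun j => wd (μ1p j))} {ce co : HS (fun j => wd (μ1m j))}
    {f : HS ν} (hf : HasBdry q S be bo ce co f) : HasBdry q S bo be co ce (S' f) := by
  obtain ⟨ze, zo, h1, h2, h3⟩ := hf
  exact ⟨zo, ze, h2, h1, h.isDecomp_right h3 (h1.isShell hp hm)⟩

/-- Green's formula in terms of the sums and differences of the even and odd boundary values. -/
theorem HasBdry.inner_sub_inner {be bo be' bo' : HS (fun j => wd (μ1p j))}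
    {ce co ce' co' : HS (fun j => wd (μ1m j))} {f g w w' : HS ν}
    (hf : HasBdry q S be bo ce co f) (hg : HasBdry q S be' bo' ce' co' g)
    (hw : IsMaxImage S S' f w) (hw' : IsMaxImage S S' g w') :
    2 * (inner ℂ w g - inner ℂ f w') = Complex.I *
      ((inner ℂ (be + bo) (be' + bo') - inner ℂ (ce + co) (ce' + co')) -
        (inner ℂ (be - bo) (be' - bo') - inner ℂ (ce - co) (ce' - co'))) := by
  obtain ⟨ze, zo, h1, h2, h3⟩ := hf
  obtain ⟨ze', zo', h1', h2', h3'⟩ := hg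
  have s1' := h1'.isShell hp hm
  have s2' := h2'.isShell hp hm
  obtain ⟨ye', hye'⟩ := s1'.exists_isMul h.pos
  obtain ⟨yo', hyo'⟩ := s2'.exists_isMul h.pos
  rw [h.inner_maxImage_sub h3 (h1.isShell hp hm) (h2.isShell hp hm) h3' s1' s2' hye' hyo' hw hw',
    h2.inner_eq hp hm h1' hye', h1.inner_eq hp hm h2' hyo']
  simp only [inner_add_left, inner_add_right, inner_sub_left, inner_sub_right]
  ring

end BoundaryData

section SelfAdjointExtension

variable {Ip Im : Type*} {μ1p : Ip → Measure ℝ} {μ1m : Im → Measure ℝ}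
  {ν : Ip ⊕ Im → Measure ℝ} {q : ℝ} {S S' : HS ν →L[ℂ] HS ν} {X Y : HS ν →ₗ.[ℂ] HS ν}
  {V W : HS (fun j => wd (μ1m j)) ≃ₗᵢ[ℂ] HS (fun j => wd (μ1p j))}

/-- The boundary condition given by the unitary operators `V` and `W`. -/
def BdryCond (q : ℝ) (S : HS ν →L[ℂ] HS ν)
    (V W : HS (fun j => wd (μ1m j)) ≃ₗᵢ[ℂ] HS (fun j => wd (μ1p j))) (f : HS ν) : Prop :=
  ∃ be bo ce co, HasBdry q S be bo ce co f ∧ be + bo = V (ce + co) ∧ be - bo = W (ce - co)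

variable (hp : ∀ j, IsInduced q 1 (μ1p j) (ν (Sum.inl j)))
    (hm : ∀ j, IsInduced q (-1) (μ1m j) (ν (Sum.inr j))) (h : IsDilation q ν S S')

include hp hm h

theorem BdryCond.left {f : HS ν} (hf : BdryCond q S V W f) : BdryCond q S V W (S f) := by
  obtain ⟨be, bo, ce, co, h1, h2, h3⟩ := hf
  refine ⟨bo, be, co, ce, h1.left hp hm h, ?_, ?_⟩
  · rw [add_comm, h2, add_comm]
  · rw [← neg_sub, h3, ← map_neg, neg_sub]

theorem BdryCond.right {f : HS ν} (hf : BdryCond q S V W f) : BdryCond q S V W (S' f) := by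
  obtain ⟨be, bo, ce, co, h1, h2, h3⟩ := hf
  refine ⟨bo, be, co, ce, h1.right hp hm h, ?_, ?_⟩
  · rw [add_comm, h2, add_comm]
  · rw [← neg_sub, h3, ← map_neg, neg_sub]

omit h in
theorem IsMul.bdryCond {p p' : HS ν} (hpp : IsMul ν (·⁻¹) p p') : BdryCond q S V W p :=
  ⟨0, 0, 0, 0, hpp.hasBdry_zero hp hm, by simp, by simp⟩

theorem BdryCond.inner_comm {f g w w' : HS ν} (hf : BdryCond q S V W f) (hg : BdryCond q S V W g)
    (hw : IsMaxImage S S' f w) (hw' : IsMaxImage S S' g w') : inner ℂ w g = inner ℂ f w' := by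
  obtain ⟨be, bo, ce, co, h1, h2, h3⟩ := hf
  obtain ⟨be', bo', ce', co', h1', h2', h3'⟩ := hg
  have := h1.inner_sub_inner hp hm h h1' hw hw'
  rw [h2, h2', h3, h3', V.inner_map_map, W.inner_map_map, sub_self, sub_self, sub_self, mul_zero,
    mul_eq_zero] at this
  exact sub_eq_zero.1 (this.resolve_left two_ne_zero)

theorem BdryCond.of_inner_comm {g w' : HS ν} (hw' : IsMaxImage S S' g w')
    (H : ∀ f w, BdryCond q S V W f → IsMaxImage S S' f w → inner ℂ w g = inner ℂ f w') :
    BdryCond q S V W g := by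
  obtain ⟨be', bo', ce', co', hg⟩ : ∃ be bo : HS (fun j => wd (μ1p j)),
    ∃ ce co : HS (fun j => wd (μ1m j)), HasBdry q S be bo ce co g := hw'.exists_hasBdry hp hm h
  have key : ∀ a b : HS (fun j => wd (μ1m j)),
      inner ℂ (V a) (be' + bo' - V (ce' + co')) = inner ℂ (W b) (be' - bo' - W (ce' - co')) := by
    intro a b
    have e1 : ∀ x y : HS (fun j => wd (μ1m j)),
        (2⁻¹ : ℂ) • (x + y) + (2⁻¹ : ℂ) • (x - y) = x := fun x y => by
      rw [← smul_add, add_add_sub_cancel, ← two_smul ℂ, smul_smul, inv_mul_cancel₀ two_ne_zero,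
        one_smul]
    have e2 : ∀ x y : HS (fun j => wd (μ1m j)),
        (2⁻¹ : ℂ) • (x + y) - (2⁻¹ : ℂ) • (x - y) = y := fun x y => by
      rw [← smul_sub, add_sub_sub_cancel, ← two_smul ℂ, smul_smul, inv_mul_cancel₀ two_ne_zero,
        one_smul]
    have e1' : ∀ x y : HS (fun j => wd (μ1p j)),
        (2⁻¹ : ℂ) • (x + y) + (2⁻¹ : ℂ) • (x - y) = x := fun x y => by
      rw [← smul_add, add_add_sub_cancel, ← two_smul ℂ, smul_smul, inv_mul_cancel₀ two_ne_zero,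
        one_smul]
    have e2' : ∀ x y : HS (fun j => wd (μ1p j)),
        (2⁻¹ : ℂ) • (x + y) - (2⁻¹ : ℂ) • (x - y) = y := fun x y => by
      rw [← smul_sub, add_sub_sub_cancel, ← two_smul ℂ, smul_smul, inv_mul_cancel₀ two_ne_zero,
        one_smul]
    obtain ⟨f, hf⟩ := _root_.exists_hasBdry hp hm h ((2⁻¹ : ℂ) • (V a + W b))
      ((2⁻¹ : ℂ) • (V a - W b)) ((2⁻¹ : ℂ) • (a + b)) ((2⁻¹ : ℂ) • (a - b))
    obtain ⟨w, hw⟩ := hf.exists_isMaxImage hp hm h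
    have k1 := H f w ⟨_, _, _, _, hf, by rw [e1', e1], by rw [e2', e2]⟩ hw
    have k2 := hf.inner_sub_inner hp hm h hg hw hw'
    rw [e1, e2, e1', e2', k1, sub_self, mul_zero, eq_comm, mul_eq_zero, sub_eq_zero] at k2
    rw [inner_sub_right, inner_sub_right, V.inner_map_map, W.inner_map_map]
    exact k2.resolve_left Complex.I_ne_zero
  refine ⟨be', bo', ce', co', hg, ?_, ?_⟩
  · have := key (V.symm (be' + bo' - V (ce' + co'))) 0
    rw [V.apply_symm_apply, map_zero, inner_zero_left, inner_self_eq_zero] at this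
    exact sub_eq_zero.1 this
  · have := key 0 (W.symm (be' - bo' - W (ce' - co')))
    rw [W.apply_symm_apply, map_zero, inner_zero_left, eq_comm, inner_self_eq_zero] at this
    exact sub_eq_zero.1 this

variable (hX : IsXop q ν X) (hYle : Y ≤ X.adjoint)
  (hY : ∀ f, f ∈ Y.domain ↔ BdryCond q S V W f)

include hX hYle

omit hp hm in
theorem IsXop.isMaxImage_of_le_adjoint (f : Y.domain) : IsMaxImage S S' f (Y f) := by
  have := hX.isMaxImage_adjoint h ⟨f, hYle.1 f.2⟩
  rwa [← hYle.2 (x := f) (y := ⟨f, hYle.1 f.2⟩) rfl] at this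

include hY

theorem IsXop.le_of_bdryCond : X ≤ Y := by
  have hdom : X.domain ≤ Y.domain := fun f hf => by
    obtain ⟨f', hf'⟩ := hX.mem_domain_iff.1 hf
    exact (hY f).2 (hf'.bdryCond hp hm)
  refine ⟨hdom, fun x y hxy => ?_⟩
  have h1 := hX.isMaxImage h x
  have h2 := hX.isMaxImage_of_le_adjoint h hYle y
  rw [← hxy] at h2
  exact IsMul.unique h1 h2

theorem IsXop.isSelfAdjoint_of_bdryCond : IsSelfAdjoint Y := by
  have hXY := hX.le_of_bdryCond hp hm h hYle hY
  have hd : Dense (Y.domain : Set (HS ν)) := (hX.dense_domain h).mono hXY.1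
  have hYim := hX.isMaxImage_of_le_adjoint h hYle
  have hle : Y ≤ Y.adjoint := LinearPMap.IsFormalAdjoint.le_adjoint hd fun f g =>
    BdryCond.inner_comm hp hm h ((hY _).1 f.2) ((hY _).1 g.2) (hYim f) (hYim g)
  have hge : Y.adjoint.domain ≤ Y.domain := fun g hg => by
    have hYY := LinearPMap.adjoint_isFormalAdjoint hd ⟨g, hg⟩
    have hw : IsMaxImage S S' g (Y.adjoint ⟨g, hg⟩) := by
      refine hX.isMaxImage_of_inner h fun f => ?_
      rw [hXY.2 (x := f) (y := ⟨f, hXY.1 f.2⟩) rfl]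
      exact hYY ⟨f, hXY.1 f.2⟩
    refine (hY g).2 (BdryCond.of_inner_comm hp hm h hw fun f w hf hfw => ?_)
    have hf' : f ∈ Y.domain := (hY f).2 hf
    rw [IsMul.unique hfw (hYim ⟨f, hf'⟩), ← inner_conj_symm, ← hYY ⟨f, hf'⟩, inner_conj_symm]
  exact (LinearPMap.eq_of_le_of_domain_eq hle (le_antisymm hle.1 hge)).symm

end SelfAdjointExtension

section Identification

variable {Ip Im : Type*} {μ1p μp : Ip → Measure ℝ} {μ1m μm : Im → Measure ℝ} {q : ℝ}

theorem IsInducedPlus.isInduced (hq0 : 0 < q) (hq1 : q < 1) {μ1 μ : Measure ℝ}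
    (hs : μ1 (Set.Ico q 1)ᶜ = 0) (h : IsInducedPlus q μ1 μ) : IsInduced q 1 μ1 μ := by
  refine IsInduced.of_image hq0 hq1 (one_mul 1) hs ?_ fun M hM hMs n => ?_
  · filter_upwards [show ∀ᵐ t ∂μ, t ∈ Set.Ioi (0 : ℝ) from h.1] with t ht
    rwa [one_mul]
  · simpa only [one_mul] using h.2 M hM hMs n

theorem IsInducedMinus.isInduced (hq0 : 0 < q) (hq1 : q < 1) {μ1 μ : Measure ℝ}
    (hs : μ1 (Set.Ico q 1)ᶜ = 0) (h : IsInducedMinus q μ1 μ) : IsInduced q (-1) μ1 μ := by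
  refine IsInduced.of_image hq0 hq1 (by norm_num) hs ?_ fun M hM hMs n => ?_
  · filter_upwards [show ∀ᵐ t ∂μ, t ∈ Set.Iio (0 : ℝ) from h.1] with t ht
    rw [neg_one_mul]
    exact neg_pos.2 ht
  · simpa only [neg_mul, one_mul] using h.2 M hM hMs n

theorem isBdry_iff {S S' : HS (Sum.elim μp μm) →L[ℂ] HS (Sum.elim μp μm)}
    {X : HS (Sum.elim μp μm) →ₗ.[ℂ] HS (Sum.elim μp μm)}
    (hp : ∀ j, IsInduced q 1 (μ1p j) (Sum.elim μp μm (Sum.inl j)))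
    (hm : ∀ j, IsInduced q (-1) (μ1m j) (Sum.elim μp μm (Sum.inr j)))
    (h : IsDilation q (Sum.elim μp μm) S S') (hX : IsXop q (Sum.elim μp μm) X)
    {f : HS (Sum.elim μp μm)} {be bo : HS (fun j => wd (μ1p j))}
    {ce co : HS (fun j => wd (μ1m j))} :
    IsBdry q μp μm μ1p μ1m X f be bo ce co ↔ HasBdry q S be bo ce co f := by
  constructor
  · rintro ⟨-, p, hpX, h1, h2⟩
    obtain ⟨p', hpp⟩ := hX.mem_domain_iff.1 hpX
    obtain ⟨ze, hze⟩ := exists_isEmb hp hm be ce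
    obtain ⟨zo, hzo⟩ := exists_isEmb hp hm bo co
    obtain ⟨ve, hve⟩ := h.exists_sub_left_left ze
    obtain ⟨vo, hvo⟩ := h.exists_sub_left_left zo
    refine ⟨ze, zo, hze, hzo, p, p', ve, vo, hpp, hve, hvo, HS.ext_ae ?_⟩
    rintro (j | j)
    · refine (h.exists_ext_iff (hp j) hve hvo (hze.isShell hp hm) (hzo.isShell hp hm)
        (hze.1 j) (hzo.1 j)).1 ?_
      obtain ⟨fe, fo, k1, k2, k3⟩ := h1 j
      exact ⟨fe, fo, by simpa only [one_mul] using k1, by simpa only [one_mul] using k2, k3⟩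
    · refine (h.exists_ext_iff (hm j) hve hvo (hze.isShell hp hm) (hzo.isShell hp hm)
        (hze.2 j) (hzo.2 j)).1 ?_
      obtain ⟨fe, fo, k1, k2, k3⟩ := h2 j
      exact ⟨fe, fo, isEvenExtNeg_iff.1 k1, isOddExtNeg_iff.1 k2, k3⟩
  · intro hf
    obtain ⟨w, hw⟩ := hf.exists_isMaxImage hp hm h
    obtain ⟨ze, zo, hze, hzo, p, p', ve, vo, hpp, hve, hvo, e⟩ := hf
    refine ⟨hX.mem_adjoint_domain h hw, p, hX.mem_domain_iff.2 ⟨p', hpp⟩, fun j => ?_,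
      fun j => ?_⟩
    · obtain ⟨fe, fo, k1, k2, k3⟩ :=
        (h.exists_ext_iff (p := p) (f := f) (hp j) hve hvo (hze.isShell hp hm) (hzo.isShell hp hm)
          (hze.1 j) (hzo.1 j)).2 (by rw [e]; exact ae_of_all _ fun _ => rfl)
      exact ⟨fe, fo, by simpa only [one_mul] using k1, by simpa only [one_mul] using k2, k3⟩
    · obtain ⟨fe, fo, k1, k2, k3⟩ :=
        (h.exists_ext_iff (p := p) (f := f) (hm j) hve hvo (hze.isShell hp hm) (hzo.isShell hp hm)
          (hze.2 j) (hzo.2 j)).2 (by rw [e]; exact ae_of_all _ fun _ => rfl)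
      exact ⟨fe, fo, isEvenExtNeg_iff.2 k1, isOddExtNeg_iff.2 k2, k3⟩

end Identification

/-- **Proposition 3, direct part.** For any unitary operators
`V, W : 𝕳₋ → 𝕳₊`, the operator `X_{V,W}` (the restriction of `X*` to the domain cut out
by the boundary conditions) is a self-adjoint extension of `X`; moreover `U` maps
`D(X_{V,W})` onto itself and `U* X_{V,W} U = q X_{V,W}`. -/
theorem stmt_11 (q : ℝ) (hq0 : 0 < q) (hq1 : q < 1)
    {Ip Im : Type} (μ1p : Ip → Measure ℝ) (μ1m : Im → Measure ℝ)
    [∀ j, IsFiniteMeasure (μ1p j)] [∀ j, IsFiniteMeasure (μ1m j)]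
    (hsp : ∀ j, μ1p j (Set.Ico q 1)ᶜ = 0) (hsm : ∀ j, μ1m j (Set.Ico q 1)ᶜ = 0)
    (μp : Ip → Measure ℝ) (μm : Im → Measure ℝ)
    (hp : ∀ j, IsInducedPlus q (μ1p j) (μp j))
    (hm : ∀ j, IsInducedMinus q (μ1m j) (μm j))
    (U : HS (Sum.elim μp μm) ≃ₗᵢ[ℂ] HS (Sum.elim μp μm))
    (hU : IsUop q (Sum.elim μp μm) U)
    (X : HS (Sum.elim μp μm) →ₗ.[ℂ] HS (Sum.elim μp μm))
    (hX : IsXop q (Sum.elim μp μm) X)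
    (V W : HS (fun j => wd (μ1m j)) ≃ₗᵢ[ℂ] HS (fun j => wd (μ1p j)))
    (Y : HS (Sum.elim μp μm) →ₗ.[ℂ] HS (Sum.elim μp μm))
    (hYle : Y ≤ X.adjoint)
    (hYdom : ∀ f, f ∈ Y.domain ↔ MemXVW q μp μm μ1p μ1m X V W f) :
    IsSelfAdjoint Y ∧ X ≤ Y ∧
    (∀ f : HS (Sum.elim μp μm), f ∈ Y.domain → U f ∈ Y.domain) ∧
    (∀ f : HS (Sum.elim μp μm), f ∈ Y.domain → U.symm f ∈ Y.domain) ∧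
    (∀ (f : HS (Sum.elim μp μm)) (hf : f ∈ Y.domain) (hUf : U f ∈ Y.domain),
      U.symm (Y ⟨U f, hUf⟩) = (q : ℂ) • Y ⟨f, hf⟩) := by
  have hIp : ∀ j, IsInduced q 1 (μ1p j) (Sum.elim μp μm (Sum.inl j)) :=
    fun j => (hp j).isInduced hq0 hq1 (hsp j)
  have hIm : ∀ j, IsInduced q (-1) (μ1m j) (Sum.elim μp μm (Sum.inr j)) :=
    fun j => (hm j).isInduced hq0 hq1 (hsm j)
  have h := hU.isDilation hq0 hq1
    (by
      rintro (j | j)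
      · filter_upwards [(hIp j).ae_pos] with t ht h0
        simp [h0] at ht
      · filter_upwards [(hIm j).ae_pos] with t ht h0
        simp [h0] at ht)
    (by
      rintro (j | j) p hpt
      · exact (hIp j).ae_mul hpt
      · exact (hIm j).ae_mul hpt)
    (by
      rintro (j | j) p hpt
      · exact (hIp j).ae_inv_mul hpt
      · exact (hIm j).ae_inv_mul hpt)
  have hc0 : ((q ^ ((1 : ℝ) / 2) : ℝ) : ℂ) ≠ 0 := by
    exact_mod_cast (Real.rpow_pos_of_pos hq0 _).ne'
  set c : ℂ := ((q ^ ((1 : ℝ) / 2) : ℝ) : ℂ)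
  set S : HS (Sum.elim μp μm) →L[ℂ] HS (Sum.elim μp μm) :=
    c • (U.symm.toContinuousLinearEquiv : HS (Sum.elim μp μm) →L[ℂ] HS (Sum.elim μp μm)) with hS
  set S' : HS (Sum.elim μp μm) →L[ℂ] HS (Sum.elim μp μm) :=
    c⁻¹ • (U.toContinuousLinearEquiv : HS (Sum.elim μp μm) →L[ℂ] HS (Sum.elim μp μm)) with hS'
  have hUS : ∀ f, U f = c • S' f := fun f => by
    rw [hS']
    exact (smul_inv_smul₀ hc0 (U f)).symm
  have hUS' : ∀ f, U.symm f = c⁻¹ • S f := fun f => by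
    rw [hS]
    exact (inv_smul_smul₀ hc0 (U.symm f)).symm
  have hY : ∀ f, f ∈ Y.domain ↔ BdryCond q S V W f := fun f => by
    simp only [hYdom, MemXVW, BdryCond, isBdry_iff hIp hIm h hX]
  refine ⟨hX.isSelfAdjoint_of_bdryCond hIp hIm h hYle hY,
    hX.le_of_bdryCond hIp hIm h hYle hY, fun f hf => ?_, fun f hf => ?_, fun f hf hUf => ?_⟩
  · rw [hUS]
    exact Y.domain.smul_mem _ ((hY _).2 (((hY f).1 hf).right hIp hIm h))
  · rw [hUS']
    exact Y.domain.smul_mem _ ((hY _).2 (((hY f).1 hf).left hIp hIm h))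
  · have h1 := hX.isMaxImage_of_le_adjoint h hYle ⟨U f, hUf⟩
    have h2 := h.isMaxImage_right (hX.isMaxImage_of_le_adjoint h hYle ⟨f, hf⟩)
    have h3 : IsMaxImage S S' (U f) ((q : ℂ) • U (Y ⟨f, hf⟩)) := by
      have := h2.smul c
      rw [smul_comm c (q : ℂ), ← hUS] at this
      rw [IsMaxImage, hUS f, map_smul, map_smul, ← smul_sub, smul_comm]
      exact this
    rw [IsMul.unique h1 h3, map_smul, U.symm_apply_apply]

end
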